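/- If A ∈ SL₂(ℝ)^κ satisfies L(A) > 0, then there exist a neighborhood U of A in SL₂(ℝ)^κ and constants C, α, β > 0 such that for all B₁, B₂ ∈ U with B₁ ≠ B₂, |L(B₁) − L(B₂)| ≤ C exp(−α (log(1/‖B₁ − B₂‖))^β); that is, L is weak-Hölder continuous on a neighborhood of A. (Duarte–Klein weak-Hölder theorem.) -/

import Mathlib

open MeasureTheory

noncomputable section

abbrev Mat2 : Type := Matrix (Fin 2) (Fin 2) ℝ
abbrev SL2 : Type := Matrix.SpecialLinearGroup (Fin 2) ℝ
abbrev E2 : Type := EuclideanSpace ℝ (Fin 2)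
abbrev Pone : Type := Projectivization ℝ E2

instance : TopologicalSpace SL2 :=
  inferInstanceAs (TopologicalSpace { A : Mat2 // A.det = 1 })

/-- The operator norm of a 2×2 real matrix, acting on Euclidean ℝ². -/
def opNorm (M : Mat2) : ℝ := ‖Matrix.toEuclideanCLM (𝕜 := ℝ) M‖

/-- The continuous linear map on Euclidean ℝ² induced by a matrix in SL₂(ℝ). -/
def toEuc (g : SL2) : E2 →L[ℝ] E2 := Matrix.toEuclideanCLM (𝕜 := ℝ) (g : Mat2)

lemma toEuc_injective (g : SL2) : Function.Injective (toEuc g) := by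
  intro x y hxy
  have key : ∀ z, toEuc g⁻¹ (toEuc g z) = z := by
    intro z
    have h1 : ((g⁻¹ : SL2) : Mat2) * (g : Mat2) = 1 := by
      rw [← Matrix.SpecialLinearGroup.coe_mul, inv_mul_cancel,
        Matrix.SpecialLinearGroup.coe_one]
    calc toEuc g⁻¹ (toEuc g z)
        = (Matrix.toEuclideanCLM (𝕜 := ℝ) (((g⁻¹ : SL2) : Mat2) * (g : Mat2))) z := by
          rw [map_mul]; rfl
      _ = z := by rw [h1, map_one]; rfl
  have := congrArg (toEuc g⁻¹) hxy
  rwa [key, key] at this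

/-- The projective action of SL₂(ℝ) on the real projective line ℙ¹. -/
def pact (g : SL2) : Pone → Pone :=
  Projectivization.map (toEuc g).toLinearMap (toEuc_injective g)

instance : MeasurableSpace Pone :=
  inferInstanceAs (MeasurableSpace (Quotient (projectivizationSetoid ℝ E2)))

instance : TopologicalSpace Pone :=
  inferInstanceAs (TopologicalSpace (Quotient (projectivizationSetoid ℝ E2)))

/-- The ordered product `A_{w_{n-1}} ⋯ A_{w_1} A_{w_0}` of the matrices along a word `w`. -/
def wordProd {κ : ℕ} (A : Fin κ → SL2) {n : ℕ} (w : Fin n → Fin κ) : SL2 :=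
  (List.ofFn fun i => A (w i)).reverse.prod

/-- The Lyapunov exponent of the random product of the matrices `A_1, …, A_κ` with
probabilities `p_1, …, p_κ`:
`L(p,A) = inf_{n ≥ 1} (1/n) ∫_Σ log‖A^n(x)‖ dμ_p(x) = inf_{n ≥ 1} (1/n) Σ_w p(w) log‖A_w‖`,
the integral over the Bernoulli measure `μ_p = p^ℤ` being a finite sum over words of
length `n` since the cocycle is locally constant. -/
def lyapLC {κ : ℕ} (p : Fin κ → ℝ) (A : Fin κ → SL2) : ℝ :=
  ⨅ n : {m : ℕ // 0 < m},
    (((n : ℕ) : ℝ))⁻¹ * ∑ w : Fin (n : ℕ) → Fin κ,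
      (∏ i, p (w i)) * Real.log (opNorm ((wordProd A w : SL2) : Mat2))

/-- The distance `‖B₁ − B₂‖` on tuples of matrices (sup of the operator norms of the
differences of the components). -/
def tdist {κ : ℕ} (B₁ B₂ : Fin κ → SL2) : ℝ :=
  ⨆ i, opNorm ((B₁ i : Mat2) - (B₂ i : Mat2))

section part1
open MeasureTheory

/-! ### Basic 2×2 algebra with the Frobenius norm squared -/

def nsq (M : Mat2) : ℝ := M 0 0 ^ 2 + M 0 1 ^ 2 + M 1 0 ^ 2 + M 1 1 ^ 2

def act (M : Mat2) (v : ℝ × ℝ) : ℝ × ℝ :=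
  (M 0 0 * v.1 + M 0 1 * v.2, M 1 0 * v.1 + M 1 1 * v.2)

def qf (v : ℝ × ℝ) : ℝ := v.1 ^ 2 + v.2 ^ 2

lemma qf_nonneg (v : ℝ × ℝ) : 0 ≤ qf v := by unfold qf; positivity

lemma qf_pos {v : ℝ × ℝ} (hv : v ≠ 0) : 0 < qf v := by
  rcases lt_or_eq_of_le (qf_nonneg v) with h | h
  · exact h
  · exfalso; apply hv
    unfold qf at h
    have h1 : v.1 = 0 := by nlinarith [sq_nonneg v.1, sq_nonneg v.2]
    have h2 : v.2 = 0 := by nlinarith [sq_nonneg v.1, sq_nonneg v.2]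
    exact Prod.ext h1 h2

lemma ne_zero_of_qf {v : ℝ × ℝ} (hv : 0 < qf v) : v ≠ 0 := by
  rintro rfl; simp [qf] at hv

lemma nsq_nonneg (M : Mat2) : 0 ≤ nsq M := by unfold nsq; positivity

lemma mul00 (M N : Mat2) : (M * N) 0 0 = M 0 0 * N 0 0 + M 0 1 * N 1 0 := by
  simp [Matrix.mul_apply, Fin.sum_univ_two]
lemma mul01 (M N : Mat2) : (M * N) 0 1 = M 0 0 * N 0 1 + M 0 1 * N 1 1 := by
  simp [Matrix.mul_apply, Fin.sum_univ_two]
lemma mul10 (M N : Mat2) : (M * N) 1 0 = M 1 0 * N 0 0 + M 1 1 * N 1 0 := by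
  simp [Matrix.mul_apply, Fin.sum_univ_two]
lemma mul11 (M N : Mat2) : (M * N) 1 1 = M 1 0 * N 0 1 + M 1 1 * N 1 1 := by
  simp [Matrix.mul_apply, Fin.sum_univ_two]

lemma act_mul (M N : Mat2) (v : ℝ × ℝ) : act (M * N) v = act M (act N v) := by
  unfold act; simp only [mul00, mul01, mul10, mul11]
  ext <;> simp <;> ring

lemma act_one (v : ℝ × ℝ) : act 1 v = v := by
  unfold act; ext <;> simp

lemma act_smul (M : Mat2) (c : ℝ) (v : ℝ × ℝ) : act M (c • v) = c • act M v := by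
  unfold act; ext <;> simp <;> ring

lemma qf_smul (c : ℝ) (v : ℝ × ℝ) : qf (c • v) = c ^ 2 * qf v := by
  unfold qf; simp; ring

lemma qf_act_le (M : Mat2) (v : ℝ × ℝ) : qf (act M v) ≤ nsq M * qf v := by
  unfold qf act nsq; simp only
  nlinarith [sq_nonneg (M 0 0 * v.2 - M 0 1 * v.1), sq_nonneg (M 1 0 * v.2 - M 1 1 * v.1)]

lemma nsq_eq_cols (M : Mat2) : nsq M = qf (act M (1, 0)) + qf (act M (0, 1)) := by
  unfold nsq qf act; simp; ring

lemma nsq_mul_le (M N : Mat2) : nsq (M * N) ≤ nsq M * nsq N := by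
  have h : ∀ X : Mat2, nsq X = qf (act X (1, 0)) + qf (act X (0, 1)) := nsq_eq_cols
  rw [h (M * N), h N, act_mul, act_mul, mul_add]
  exact add_le_add (qf_act_le _ _) (qf_act_le _ _)

lemma two_le_nsq {M : Mat2} (h : M.det = 1) : 2 ≤ nsq M := by
  rw [Matrix.det_fin_two] at h
  unfold nsq
  nlinarith [sq_nonneg (M 0 0 - M 1 1), sq_nonneg (M 0 1 + M 1 0)]

lemma nsq_adj (M : Mat2) : nsq M.adjugate = nsq M := by
  rw [Matrix.adjugate_fin_two]; unfold nsq; simp; ring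

lemma adj_mul {M : Mat2} (h : M.det = 1) : M.adjugate * M = 1 := by
  rw [Matrix.adjugate_mul, h, one_smul]
lemma mul_adj {M : Mat2} (h : M.det = 1) : M * M.adjugate = 1 := by
  rw [Matrix.mul_adjugate, h, one_smul]

lemma nsq_le_left {M : Mat2} (h : M.det = 1) (N : Mat2) : nsq N ≤ nsq M * nsq (M * N) := by
  calc nsq N = nsq (M.adjugate * (M * N)) := by rw [← mul_assoc, adj_mul h, one_mul]
    _ ≤ _ := by rw [← nsq_adj M]; exact nsq_mul_le _ _

lemma nsq_le_right {M : Mat2} (h : M.det = 1) (N : Mat2) : nsq N ≤ nsq (N * M) * nsq M := by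
  calc nsq N = nsq ((N * M) * M.adjugate) := by rw [mul_assoc, mul_adj h, mul_one]
    _ ≤ _ := by rw [← nsq_adj M]; exact nsq_mul_le _ _

lemma qf_le_act {M : Mat2} (h : M.det = 1) (v : ℝ × ℝ) : qf v ≤ nsq M * qf (act M v) := by
  calc qf v = qf (act M.adjugate (act M v)) := by rw [← act_mul, adj_mul h, act_one]
    _ ≤ _ := by rw [← nsq_adj M]; exact qf_act_le _ _

lemma qf_act_pos {M : Mat2} (h : M.det = 1) {v : ℝ × ℝ} (hv : 0 < qf v) : 0 < qf (act M v) := by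
  have h1 := qf_le_act h v
  have h2 := two_le_nsq h
  by_contra hc
  nlinarith [qf_nonneg (act M v)]

lemma act_ne_zero {M : Mat2} (h : M.det = 1) {v : ℝ × ℝ} (hv : v ≠ 0) : act M v ≠ 0 :=
  ne_zero_of_qf (qf_act_pos h (qf_pos hv))

/-! ### Expectations over random words -/

variable {κ : ℕ}

/-- Expectation of `f (B_{w_{n-1}} ⋯ B_{w_0})` over random words. -/
def Ex (p : Fin κ → ℝ) (B : Fin κ → Mat2) : ℕ → (Mat2 → ℝ) → ℝ
  | 0, f => f 1
  | n + 1, f => ∑ i, p i * Ex p B n (fun M => f (M * B i))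

lemma Ex_zero (p : Fin κ → ℝ) (B : Fin κ → Mat2) (f : Mat2 → ℝ) : Ex p B 0 f = f 1 := rfl
lemma Ex_succ (p : Fin κ → ℝ) (B : Fin κ → Mat2) (n : ℕ) (f : Mat2 → ℝ) :
    Ex p B (n + 1) f = ∑ i, p i * Ex p B n (fun M => f (M * B i)) := rfl

lemma Ex_left (p : Fin κ → ℝ) (B : Fin κ → Mat2) (n : ℕ) (f : Mat2 → ℝ) :
    Ex p B (n + 1) f = ∑ i, p i * Ex p B n (fun M => f (B i * M)) := by
  induction n generalizing f with
  | zero => simp [Ex]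
  | succ n ih =>
    rw [Ex_succ]
    conv_lhs => simp only [ih]
    conv_rhs => simp only [Ex_succ]
    simp_rw [Finset.mul_sum]
    rw [Finset.sum_comm]
    refine Finset.sum_congr rfl fun i _ => Finset.sum_congr rfl fun j _ => ?_
    simp only [mul_assoc]; ring

lemma Ex_add (p : Fin κ → ℝ) (B : Fin κ → Mat2) (n m : ℕ) (f : Mat2 → ℝ) :
    Ex p B (n + m) f = Ex p B n (fun N => Ex p B m (fun M => f (M * N))) := by
  induction n generalizing f with
  | zero => simp [Ex]
  | succ n ih =>
    rw [Nat.succ_add, Ex_succ, Ex_succ]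
    simp_rw [ih, mul_assoc]

lemma Ex_lin (p : Fin κ → ℝ) (B : Fin κ → Mat2) (n : ℕ) (f g : Mat2 → ℝ) (a b : ℝ) :
    Ex p B n (fun M => a * f M + b * g M) = a * Ex p B n f + b * Ex p B n g := by
  induction n generalizing f g with
  | zero => simp [Ex]
  | succ n ih =>
    simp_rw [Ex_succ, ih, Finset.mul_sum, ← Finset.sum_add_distrib]
    refine Finset.sum_congr rfl fun i _ => by ring

lemma Ex_sub (p : Fin κ → ℝ) (B : Fin κ → Mat2) (n : ℕ) (f g : Mat2 → ℝ) :
    Ex p B n (fun M => f M - g M) = Ex p B n f - Ex p B n g := by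
  have := Ex_lin p B n f g 1 (-1)
  simpa [sub_eq_add_neg] using this

lemma Ex_addf (p : Fin κ → ℝ) (B : Fin κ → Mat2) (n : ℕ) (f g : Mat2 → ℝ) :
    Ex p B n (fun M => f M + g M) = Ex p B n f + Ex p B n g := by
  have := Ex_lin p B n f g 1 1
  simpa using this

lemma Ex_smul (p : Fin κ → ℝ) (B : Fin κ → Mat2) (n : ℕ) (f : Mat2 → ℝ) (a : ℝ) :
    Ex p B n (fun M => a * f M) = a * Ex p B n f := by
  have := Ex_lin p B n f f a 0
  simpa using this

lemma Ex_const {p : Fin κ → ℝ} (hp1 : ∑ i, p i = 1) (B : Fin κ → Mat2) (n : ℕ) (c : ℝ) :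
    Ex p B n (fun _ => c) = c := by
  induction n with
  | zero => simp [Ex]
  | succ n ih => rw [Ex_succ]; simp_rw [ih, ← Finset.sum_mul, hp1, one_mul]

lemma Ex_sum {ι : Type*} (s : Finset ι) (p : Fin κ → ℝ) (B : Fin κ → Mat2) (n : ℕ)
    (c : ι → ℝ) (f : ι → Mat2 → ℝ) :
    Ex p B n (fun M => ∑ j ∈ s, c j * f j M) = ∑ j ∈ s, c j * Ex p B n (f j) := by
  classical
  induction s using Finset.induction_on with
  | empty =>
    simp only [Finset.sum_empty]
    have := Ex_smul p B n (fun _ => 0) 0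
    simpa using this
  | insert a s ha ih =>
    simp_rw [Finset.sum_insert ha]
    rw [Ex_addf, ih, Ex_smul]

/-- Comparison of two expectations along coupled words. -/
lemma Ex_rel {p : Fin κ → ℝ} (hp : ∀ i, 0 ≤ p i) (hp1 : ∑ i, p i = 1) (B C : Fin κ → Mat2)
    (P : ℕ → Mat2 → Mat2 → Prop) (h0 : P 0 1 1)
    (hs : ∀ n M N i, P n M N → P (n + 1) (M * B i) (N * C i))
    (n : ℕ) (f g : Mat2 → ℝ) (c : ℝ) (h : ∀ M N, P n M N → f M ≤ g N + c) :
    Ex p B n f ≤ Ex p C n g + c := by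
  induction n generalizing f g with
  | zero => exact h 1 1 h0
  | succ n ih =>
    have h1 : ∀ i, Ex p B n (fun M => f (M * B i)) ≤ Ex p C n (fun M => g (M * C i)) + c :=
      fun i => ih _ _ fun M N hMN => h _ _ (hs n M N i hMN)
    rw [Ex_succ, Ex_succ]
    calc _ ≤ ∑ i, p i * (Ex p C n (fun M => g (M * C i)) + c) :=
          Finset.sum_le_sum fun i _ => mul_le_mul_of_nonneg_left (h1 i) (hp i)
      _ = _ := by simp_rw [mul_add, Finset.sum_add_distrib, ← Finset.sum_mul, hp1, one_mul]

lemma Ex_mono_P {p : Fin κ → ℝ} (hp : ∀ i, 0 ≤ p i) (hp1 : ∑ i, p i = 1) (B : Fin κ → Mat2)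
    (P : ℕ → Mat2 → Prop) (h0 : P 0 1)
    (hs : ∀ n M i, P n M → P (n + 1) (M * B i))
    (n : ℕ) (f g : Mat2 → ℝ) (h : ∀ M, P n M → f M ≤ g M) :
    Ex p B n f ≤ Ex p B n g := by
  have := Ex_rel hp hp1 B B (fun n M N => M = N ∧ P n M) ⟨rfl, h0⟩
    (fun n M N i hMN => ⟨by rw [hMN.1], hs n M i hMN.2⟩) n f g 0
    (fun M N hMN => by rw [← hMN.1, add_zero]; exact h M hMN.2)
  simpa using this

/-- For tuples in `SL₂`, comparison only on `det = 1` matrices with controlled norm. -/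
lemma Ex_mono_K {p : Fin κ → ℝ} (hp : ∀ i, 0 ≤ p i) (hp1 : ∑ i, p i = 1) {B : Fin κ → Mat2}
    (hB : ∀ i, (B i).det = 1) {K : ℝ} (hK : ∀ i, nsq (B i) ≤ K)
    (n : ℕ) (f g : Mat2 → ℝ) (h : ∀ M : Mat2, M.det = 1 → nsq M ≤ 2 * K ^ n → f M ≤ g M) :
    Ex p B n f ≤ Ex p B n g := by
  refine Ex_mono_P hp hp1 B (fun n M => M.det = 1 ∧ nsq M ≤ 2 * K ^ n) ⟨by simp, ?_⟩ ?_ n f g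
    (fun M hM => h M hM.1 hM.2)
  · simp [nsq]; norm_num
  · rintro n M i ⟨h1, h2⟩
    refine ⟨by rw [Matrix.det_mul, h1, hB, one_mul], ?_⟩
    have := nsq_mul_le M (B i)
    have h3 := nsq_nonneg M
    have h4 := nsq_nonneg (B i)
    calc _ ≤ nsq M * nsq (B i) := this
      _ ≤ (2 * K ^ n) * K := mul_le_mul h2 (hK i) h4 (h3.trans h2)
      _ = _ := by ring

lemma Ex_mono {p : Fin κ → ℝ} (hp : ∀ i, 0 ≤ p i) (hp1 : ∑ i, p i = 1) {B : Fin κ → Mat2}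
    (hB : ∀ i, (B i).det = 1)
    (n : ℕ) (f g : Mat2 → ℝ) (h : ∀ M : Mat2, M.det = 1 → f M ≤ g M) :
    Ex p B n f ≤ Ex p B n g :=
  Ex_mono_P hp hp1 B (fun _ M => M.det = 1) (by simp)
    (fun n M i hM => by rw [Matrix.det_mul, hM, hB, one_mul]) n f g h

lemma Ex_congr {p : Fin κ → ℝ} (hp : ∀ i, 0 ≤ p i) (hp1 : ∑ i, p i = 1) {B : Fin κ → Mat2}
    (hB : ∀ i, (B i).det = 1)
    (n : ℕ) (f g : Mat2 → ℝ) (h : ∀ M : Mat2, M.det = 1 → f M = g M) :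
    Ex p B n f = Ex p B n g :=
  le_antisymm (Ex_mono hp hp1 hB n f g fun M hM => (h M hM).le)
    (Ex_mono hp hp1 hB n g f fun M hM => (h M hM).ge)

/-- Conjugation. -/
lemma Ex_conj (p : Fin κ → ℝ) (B : Fin κ → Mat2) (P Q : Mat2) (hPQ : P * Q = 1)
    (n : ℕ) (f : Mat2 → ℝ) :
    Ex p (fun i => P * B i * Q) n f = Ex p B n (fun M => f (P * M * Q)) := by
  have hQP : Q * P = 1 := mul_eq_one_comm.mp hPQ
  induction n generalizing f with
  | zero => simp [Ex, hPQ]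
  | succ n ih =>
    rw [Ex_succ, Ex_succ]
    refine Finset.sum_congr rfl fun i _ => ?_
    rw [ih]
    congr 2
    funext M
    congr 1
    calc P * M * Q * (P * B i * Q) = P * M * (Q * P) * B i * Q := by simp only [mul_assoc]
      _ = _ := by rw [hQP]; simp only [mul_assoc, one_mul]

/-- Continuity of expectations. -/
lemma Ex_continuousAt {X : Type*} [TopologicalSpace X] (p : Fin κ → ℝ) (B : X → Fin κ → Mat2)
    (x0 : X) (hBc : ∀ i, ContinuousAt (fun x => B x i) x0) (hB : ∀ i, (B x0 i).det = 1)
    (n : ℕ) (f : X → Mat2 → ℝ)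
    (hf : ∀ M : Mat2, M.det = 1 → ContinuousAt (fun z : X × Mat2 => f z.1 z.2) (x0, M)) :
    ContinuousAt (fun x => Ex p (B x) n (f x)) x0 := by
  induction n generalizing f with
  | zero =>
    have h1 : ContinuousAt (fun x => ((x, (1 : Mat2)) : X × Mat2)) x0 :=
      continuousAt_id.prodMk continuousAt_const
    exact ContinuousAt.comp (f := fun x => ((x, (1 : Mat2)) : X × Mat2)) (x := x0)
      (hf 1 (by simp)) h1
  | succ n ih =>
    simp_rw [Ex_succ]
    refine tendsto_finsetSum _ fun i _ => ?_
    refine Filter.Tendsto.const_mul _ ?_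
    refine ih (fun x M => f x (M * B x i)) fun M hM => ?_
    have h2 := hf (M * B x0 i) (by rw [Matrix.det_mul, hM, hB, one_mul])
    have hb : ContinuousAt (fun z : X × Mat2 => B z.1 i) (x0, M) :=
      ContinuousAt.comp (f := Prod.fst) (x := (x0, M)) (hBc i) continuousAt_fst
    have h1 : ContinuousAt (fun z : X × Mat2 => ((z.1, z.2 * B z.1 i) : X × Mat2)) (x0, M) :=
      continuousAt_fst.prodMk (continuousAt_snd.mul hb)
    exact ContinuousAt.comp (f := fun z : X × Mat2 => ((z.1, z.2 * B z.1 i) : X × Mat2))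
      (x := (x0, M)) h2 h1

end part1

section part2
open MeasureTheory

/-! ### Lyapunov exponent -/
section lyap
open Filter Topology
variable {κ : ℕ}

def ell (p : Fin κ → ℝ) (B : Fin κ → Mat2) (n : ℕ) : ℝ := Ex p B n (fun M => Real.log (nsq M))

def HasLam (p : Fin κ → ℝ) (B : Fin κ → Mat2) (l : ℝ) : Prop :=
  Tendsto (fun n : ℕ => ell p B n / n) atTop (𝓝 l)

lemma ell_subadd {p : Fin κ → ℝ} (hp : ∀ i, 0 ≤ p i) (hp1 : ∑ i, p i = 1) {B : Fin κ → Mat2}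
    (hB : ∀ i, (B i).det = 1) : Subadditive (ell p B) := by
  intro m n
  unfold ell
  rw [Ex_add]
  calc _ ≤ Ex p B m (fun N => Real.log (nsq N) + ell p B n) := by
        refine Ex_mono hp hp1 hB m _ _ fun N hN => ?_
        calc _ ≤ Ex p B n (fun M => Real.log (nsq N) + Real.log (nsq M)) := by
              refine Ex_mono hp hp1 hB n _ _ fun M hM => ?_
              have h1 := two_le_nsq hM
              have h2 := two_le_nsq hN
              have h3 : 2 ≤ nsq (M * N) := two_le_nsq (by rw [Matrix.det_mul, hM, hN, one_mul])
              rw [← Real.log_mul (by linarith) (by linarith), mul_comm]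
              exact Real.log_le_log (by linarith) (nsq_mul_le M N)
          _ = _ := by rw [Ex_addf, Ex_const hp1]; rfl
    _ = _ := by rw [Ex_addf, Ex_const hp1]; rfl

lemma ell_nonneg {p : Fin κ → ℝ} (hp : ∀ i, 0 ≤ p i) (hp1 : ∑ i, p i = 1) {B : Fin κ → Mat2}
    (hB : ∀ i, (B i).det = 1) (n : ℕ) : 0 ≤ ell p B n := by
  rw [← Ex_const hp1 B n 0]
  exact Ex_mono hp hp1 hB n _ _ fun M hM =>
    Real.log_nonneg (by linarith [two_le_nsq hM])

lemma ell_bdd {p : Fin κ → ℝ} (hp : ∀ i, 0 ≤ p i) (hp1 : ∑ i, p i = 1) {B : Fin κ → Mat2}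
    (hB : ∀ i, (B i).det = 1) : BddBelow (Set.range fun n : ℕ => ell p B n / n) := by
  refine ⟨0, ?_⟩
  rintro _ ⟨n, rfl⟩
  exact div_nonneg (ell_nonneg hp hp1 hB n) (Nat.cast_nonneg n)

lemma exists_HasLam {p : Fin κ → ℝ} (hp : ∀ i, 0 ≤ p i) (hp1 : ∑ i, p i = 1) {B : Fin κ → Mat2}
    (hB : ∀ i, (B i).det = 1) : ∃ l, HasLam p B l :=
  ⟨_, (ell_subadd hp hp1 hB).tendsto_lim (ell_bdd hp hp1 hB)⟩

lemma HasLam.le {p : Fin κ → ℝ} (hp : ∀ i, 0 ≤ p i) (hp1 : ∑ i, p i = 1) {B : Fin κ → Mat2}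
    (hB : ∀ i, (B i).det = 1) {l : ℝ} (hl : HasLam p B l) (n : ℕ) : n * l ≤ ell p B n := by
  have h1 := (ell_subadd hp hp1 hB).tendsto_lim (ell_bdd hp hp1 hB)
  have h2 := tendsto_nhds_unique hl h1
  rcases Nat.eq_zero_or_pos n with rfl | hn
  · simpa using ell_nonneg hp hp1 hB 0
  · have h3 := (ell_subadd hp hp1 hB).lim_le_div (ell_bdd hp hp1 hB) hn.ne'
    rw [← h2] at h3
    have hn' : (0 : ℝ) < n := by exact_mod_cast hn
    rw [le_div_iff₀ hn'] at h3
    linarith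

lemma const_div_tendsto (C : ℝ) : Tendsto (fun n : ℕ => C / (n : ℝ)) atTop (𝓝 0) :=
  tendsto_const_div_atTop_nhds_zero_nat C

lemma HasLam.of_close {p : Fin κ → ℝ} {B : Fin κ → Mat2} {l C : ℝ} (a : ℕ → ℝ)
    (ha : Tendsto (fun n : ℕ => a n / n) atTop (𝓝 l)) (h : ∀ n, |ell p B n - a n| ≤ C) :
    HasLam p B l := by
  have h0 : Tendsto (fun n : ℕ => (ell p B n - a n) / n) atTop (𝓝 0) := by
    refine squeeze_zero_norm (fun n => ?_) (const_div_tendsto C)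
    rw [Real.norm_eq_abs, abs_div, Nat.abs_cast]
    exact div_le_div_of_nonneg_right (h n) (Nat.cast_nonneg n)
  have := ha.add h0
  rw [add_zero] at this
  refine this.congr fun n => ?_
  ring

/-! word sums -/
lemma wordProd_cons (A : Fin κ → SL2) {n : ℕ} (i : Fin κ) (w : Fin n → Fin κ) :
    wordProd A (Fin.cons i w : Fin (n + 1) → Fin κ) = wordProd A w * A i := by
  unfold wordProd
  simp [List.ofFn_succ]

lemma word_sum (p : Fin κ → ℝ) (A : Fin κ → SL2) (n : ℕ) (f : Mat2 → ℝ) :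
    ∑ w : Fin n → Fin κ, (∏ i, p (w i)) * f ((wordProd A w : SL2) : Mat2)
      = Ex p (fun i => (A i : Mat2)) n f := by
  induction n generalizing f with
  | zero => simp [Ex, wordProd]
  | succ n ih =>
    rw [Ex_succ, ← (Fin.consEquiv (fun _ => Fin κ)).sum_comp, Fintype.sum_prod_type]
    refine Finset.sum_congr rfl fun i _ => ?_
    rw [← ih, Finset.mul_sum]
    refine Finset.sum_congr rfl fun w _ => ?_
    have : (Fin.consEquiv (fun _ => Fin κ)) (i, w) = (Fin.cons i w : Fin (n + 1) → Fin κ) := rfl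
    rw [this, wordProd_cons, Fin.prod_univ_succ]
    simp [mul_assoc]

lemma euc_norm_sq (M : Mat2) (x : E2) :
    ‖Matrix.toEuclideanCLM (𝕜 := ℝ) M x‖ ^ 2 = qf (act M (x 0, x 1)) := by
  rw [EuclideanSpace.real_norm_sq_eq]
  simp [Fin.sum_univ_two, qf, act, Matrix.ofLp_toEuclideanCLM, Matrix.mulVec, dotProduct]

lemma euc_norm_sq' (x : E2) : ‖x‖ ^ 2 = qf (x 0, x 1) := by
  rw [EuclideanSpace.real_norm_sq_eq]
  simp [Fin.sum_univ_two, qf]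

lemma opNorm_nonneg' (M : Mat2) : 0 ≤ opNorm M := norm_nonneg _

lemma opNorm_sq_le (M : Mat2) : opNorm M ^ 2 ≤ nsq M := by
  have h : opNorm M ≤ Real.sqrt (nsq M) := by
    refine ContinuousLinearMap.opNorm_le_bound _ (Real.sqrt_nonneg _) fun x => ?_
    refine abs_le_of_sq_le_sq' ?_ (by positivity) |>.2
    rw [euc_norm_sq, mul_pow, Real.sq_sqrt (nsq_nonneg M), euc_norm_sq']
    exact qf_act_le _ _
  calc opNorm M ^ 2 ≤ Real.sqrt (nsq M) ^ 2 := pow_le_pow_left₀ (opNorm_nonneg' M) h 2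
    _ = _ := Real.sq_sqrt (nsq_nonneg M)

lemma nsq_le_opNorm (M : Mat2) : nsq M ≤ 2 * opNorm M ^ 2 := by
  have h : ∀ x : E2, qf (act M (x 0, x 1)) ≤ opNorm M ^ 2 * qf (x 0, x 1) := by
    intro x
    rw [← euc_norm_sq, ← euc_norm_sq', ← mul_pow]
    exact pow_le_pow_left₀ (norm_nonneg _) (ContinuousLinearMap.le_opNorm _ x) 2
  have h1 := h (!₂[1, 0])
  have h2 := h (!₂[0, 1])
  rw [nsq_eq_cols]
  simp [qf] at h1 h2 ⊢
  linarith

lemma hasLam_lyap {p : Fin κ → ℝ} (hp : ∀ i, 0 ≤ p i) (hp1 : ∑ i, p i = 1) (A : Fin κ → SL2) :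
    HasLam p (fun i => (A i : Mat2)) (2 * lyapLC p A) := by
  have hB : ∀ i, ((fun i => (A i : Mat2)) i).det = 1 := fun i => (A i).2
  have hop1 : ∀ M : Mat2, M.det = 1 → 1 ≤ opNorm M := by
    intro M hM
    have := two_le_nsq hM
    have h2 := nsq_le_opNorm M
    nlinarith [opNorm_nonneg' M]
  set a : ℕ → ℝ := fun n => Ex p (fun i => (A i : Mat2)) n (fun M => Real.log (opNorm M)) with ha
  have hopmul : ∀ M N : Mat2, opNorm (M * N) ≤ opNorm M * opNorm N := by
    intro M N; unfold opNorm; rw [map_mul]; exact norm_mul_le _ _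
  have hsub : Subadditive a := by
    intro m n
    simp only [ha]
    rw [Ex_add]
    calc _ ≤ Ex p (fun i => (A i : Mat2)) m (fun N => Real.log (opNorm N) + a n) := by
          refine Ex_mono hp hp1 hB m _ _ fun N hN => ?_
          calc _ ≤ Ex p (fun i => (A i : Mat2)) n
                (fun M => Real.log (opNorm N) + Real.log (opNorm M)) := by
                refine Ex_mono hp hp1 hB n _ _ fun M hM => ?_
                have h1 := hop1 M hM
                have h2 := hop1 N hN
                have h3 : 1 ≤ opNorm (M * N) := hop1 _ (by rw [Matrix.det_mul, hM, hN, one_mul])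
                rw [← Real.log_mul (by linarith) (by linarith), mul_comm]
                exact Real.log_le_log (by linarith) (hopmul M N)
            _ = _ := by rw [Ex_addf, Ex_const hp1]
      _ = _ := by rw [Ex_addf, Ex_const hp1]
  have hnn : ∀ n, 0 ≤ a n := by
    intro n
    rw [← Ex_const hp1 (fun i => (A i : Mat2)) n 0]
    exact Ex_mono hp hp1 hB n _ _ fun M hM => Real.log_nonneg (hop1 M hM)
  have hbdd : BddBelow (Set.range fun n : ℕ => a n / n) := by
    refine ⟨0, ?_⟩
    rintro _ ⟨n, rfl⟩
    exact div_nonneg (hnn n) (Nat.cast_nonneg n)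
  have hlim := hsub.tendsto_lim hbdd
  have hL : hsub.lim = lyapLC p A := by
    unfold Subadditive.lim lyapLC
    rw [iInf]
    congr 1
    ext y
    constructor
    · rintro ⟨n, hn, rfl⟩
      refine ⟨⟨n, hn⟩, ?_⟩
      simp only
      rw [word_sum p A n (fun M => Real.log (opNorm M)), div_eq_inv_mul]
    · rintro ⟨⟨n, hn⟩, rfl⟩
      refine ⟨n, hn, ?_⟩
      simp only
      rw [word_sum p A n (fun M => Real.log (opNorm M)), div_eq_inv_mul]
  rw [hL] at hlim
  refine HasLam.of_close (C := Real.log 2) (fun n => 2 * a n) ?_ ?_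
  · have := hlim.const_mul 2
    refine this.congr fun n => by ring
  · intro n
    have h1 : ell p (fun i => (A i : Mat2)) n ≤ 2 * a n + Real.log 2 := by
      have : 2 * a n + Real.log 2 = Ex p (fun i => (A i : Mat2)) n
          (fun M => 2 * Real.log (opNorm M) + Real.log 2) := by
        rw [Ex_addf, Ex_const hp1, Ex_smul]
      rw [this]
      refine Ex_mono hp hp1 hB n _ _ fun M hM => ?_
      have h1 := hop1 M hM
      have e : 2 * Real.log (opNorm M) + Real.log 2 = Real.log (2 * opNorm M ^ 2) := by
        rw [Real.log_mul (by norm_num) (by positivity), Real.log_pow]; push_cast; ring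
      rw [e]
      exact Real.log_le_log (by linarith [two_le_nsq hM]) (nsq_le_opNorm M)
    have h2 : 2 * a n ≤ ell p (fun i => (A i : Mat2)) n := by
      simp only [ha]
      rw [← Ex_smul]
      refine Ex_mono hp hp1 hB n _ _ fun M hM => ?_
      have h1 := hop1 M hM
      have e : 2 * Real.log (opNorm M) = Real.log (opNorm M ^ 2) := by
        rw [Real.log_pow]; push_cast; ring
      rw [e]
      exact Real.log_le_log (by positivity) (opNorm_sq_le M)
    rw [abs_le]
    constructor <;> linarith [Real.log_nonneg (x := 2) (by norm_num)]

end lyap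

end part2

section part3
open MeasureTheory

section step1
open Filter Topology
variable {κ : ℕ}

def bl (h : Mat2) (r c : ℝ × ℝ) : ℝ := r.1 * (act h c).1 + r.2 * (act h c).2

lemma bl_sq_le (h : Mat2) (r c : ℝ × ℝ) : bl h r c ^ 2 ≤ qf r * qf c * nsq h := by
  have h1 : bl h r c ^ 2 ≤ qf r * qf (act h c) := by
    unfold bl qf
    nlinarith [sq_nonneg (r.1 * (act h c).2 - r.2 * (act h c).1)]
  have h2 := mul_le_mul_of_nonneg_left (qf_act_le h c) (qf_nonneg r)
  nlinarith

lemma bl_term (h : Mat2) (r c a b : ℝ × ℝ) (ha : qf a = 1) (hb : qf b = 1) :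
    |bl h r c ^ 2 * bl h a b ^ 2 - bl h r b ^ 2 * bl h a c ^ 2|
      ≤ |h.det| * (2 * (qf r * qf c * nsq h)) := by
  have e : bl h r c ^ 2 * bl h a b ^ 2 - bl h r b ^ 2 * bl h a c ^ 2
      = h.det * (((r.1 * a.2 - r.2 * a.1) * (c.1 * b.2 - c.2 * b.1)) *
        (bl h r c * bl h a b + bl h r b * bl h a c)) := by
    rw [Matrix.det_fin_two]; unfold bl act; ring
  rw [e, abs_mul]
  refine mul_le_mul_of_nonneg_left ?_ (abs_nonneg _)
  have hr := qf_nonneg r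
  have hc := qf_nonneg c
  have hn := nsq_nonneg h
  refine abs_le_of_sq_le_sq ?_ (by positivity)
  have hD1 : (r.1 * a.2 - r.2 * a.1) ^ 2 ≤ qf r := by
    have : (r.1 * a.2 - r.2 * a.1) ^ 2 ≤ qf r * qf a := by
      unfold qf; nlinarith [sq_nonneg (r.1 * a.1 + r.2 * a.2)]
    rwa [ha, mul_one] at this
  have hD2 : (c.1 * b.2 - c.2 * b.1) ^ 2 ≤ qf c := by
    have : (c.1 * b.2 - c.2 * b.1) ^ 2 ≤ qf c * qf b := by
      unfold qf; nlinarith [sq_nonneg (c.1 * b.1 + c.2 * b.2)]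
    rwa [hb, mul_one] at this
  have hX : (bl h r c * bl h a b) ^ 2 ≤ qf r * qf c * nsq h ^ 2 := by
    rw [mul_pow]
    calc _ ≤ (qf r * qf c * nsq h) * (qf a * qf b * nsq h) :=
          mul_le_mul (bl_sq_le _ _ _) (bl_sq_le _ _ _) (sq_nonneg _) (by positivity)
      _ = _ := by rw [ha, hb]; ring
  have hY : (bl h r b * bl h a c) ^ 2 ≤ qf r * qf c * nsq h ^ 2 := by
    rw [mul_pow]
    calc _ ≤ (qf r * qf b * nsq h) * (qf a * qf c * nsq h) :=
          mul_le_mul (bl_sq_le _ _ _) (bl_sq_le _ _ _) (sq_nonneg _)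
            (mul_nonneg (mul_nonneg hr (qf_nonneg b)) hn)
      _ = _ := by rw [ha, hb]; ring
  have hXY : (bl h r c * bl h a b + bl h r b * bl h a c) ^ 2 ≤ 4 * (qf r * qf c * nsq h ^ 2) := by
    nlinarith [sq_nonneg (bl h r c * bl h a b - bl h r b * bl h a c)]
  rw [mul_pow, mul_pow]
  calc _ ≤ (qf r * qf c) * (4 * (qf r * qf c * nsq h ^ 2)) :=
        mul_le_mul (mul_le_mul hD1 hD2 (sq_nonneg _) hr) hXY (sq_nonneg _) (by positivity)
    _ = _ := by ring

lemma four_diff (g h k : Mat2) :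
    |nsq (g * h * k) * nsq h - nsq (h * k) * nsq (g * h)| ≤ 8 * (|h.det| * (nsq g * nsq k * nsq h)) := by
  set R : Fin 2 → ℝ × ℝ := fun j => (g j 0, g j 1) with hR
  set C : Fin 2 → ℝ × ℝ := fun j => (k 0 j, k 1 j) with hC
  set E : Fin 2 → ℝ × ℝ := fun j => if j = 0 then (1, 0) else (0, 1) with hE
  have hEq : ∀ j, qf (E j) = 1 := by
    intro j; fin_cases j <;> simp [hE, qf]
  have e1 : nsq (g * h * k) = ∑ j, ∑ l, bl h (R j) (C l) ^ 2 := by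
    simp only [Fin.sum_univ_two, nsq, bl, act, hR, hC, mul00, mul01, mul10, mul11]; ring
  have e2 : nsq h = ∑ j, ∑ l, bl h (E j) (E l) ^ 2 := by
    simp [Fin.sum_univ_two, nsq, bl, act, hE]; ring
  have e3 : nsq (h * k) = ∑ j, ∑ l, bl h (E j) (C l) ^ 2 := by
    simp [Fin.sum_univ_two, nsq, bl, act, hE, hC, mul00, mul01, mul10, mul11]; ring
  have e4 : nsq (g * h) = ∑ j, ∑ l, bl h (R j) (E l) ^ 2 := by
    simp [Fin.sum_univ_two, nsq, bl, act, hR, hE, mul00, mul01, mul10, mul11]; ring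
  have e5 : nsq g = ∑ j, qf (R j) := by
    simp [Fin.sum_univ_two, nsq, qf, hR]; ring
  have e6 : nsq k = ∑ j, qf (C j) := by
    simp [Fin.sum_univ_two, nsq, qf, hC]; ring
  have key : nsq (g * h * k) * nsq h - nsq (h * k) * nsq (g * h) =
      ∑ j, ∑ l, ∑ a, ∑ b, (bl h (R j) (C l) ^ 2 * bl h (E a) (E b) ^ 2
        - bl h (R j) (E b) ^ 2 * bl h (E a) (C l) ^ 2) := by
    rw [e1, e3, e4]; conv_lhs => rw [e2]
    simp only [Fin.sum_univ_two]; ring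
  rw [key]
  have T := fun j l a b => bl_term h (R j) (C l) (E a) (E b) (hEq a) (hEq b)
  calc _ ≤ ∑ j, ∑ l, ∑ a : Fin 2, ∑ b : Fin 2, |h.det| * (2 * (qf (R j) * qf (C l) * nsq h)) := by
        refine (Finset.abs_sum_le_sum_abs _ _).trans (Finset.sum_le_sum fun j _ => ?_)
        refine (Finset.abs_sum_le_sum_abs _ _).trans (Finset.sum_le_sum fun l _ => ?_)
        refine (Finset.abs_sum_le_sum_abs _ _).trans (Finset.sum_le_sum fun a _ => ?_)
        refine (Finset.abs_sum_le_sum_abs _ _).trans (Finset.sum_le_sum fun b _ => ?_)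
        exact T j l a b
    _ = _ := by rw [e5, e6]; simp only [Fin.sum_univ_two]; ring

lemma log_diff_le {x y e : ℝ} (hx : 0 < x) (hy : 0 < y) (h1 : |x - y| ≤ e * x)
    (h2 : |x - y| ≤ e * y) : |Real.log x - Real.log y| ≤ e := by
  have a1 := Real.log_le_sub_one_of_pos (div_pos hx hy)
  have a2 := Real.log_le_sub_one_of_pos (div_pos hy hx)
  rw [Real.log_div hx.ne' hy.ne'] at a1
  rw [Real.log_div hy.ne' hx.ne'] at a2
  have b1 : x / y - 1 ≤ e := by
    rw [sub_le_iff_le_add, div_le_iff₀ hy]; linarith [le_abs_self (x - y)]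
  have b2 : y / x - 1 ≤ e := by
    rw [sub_le_iff_le_add, div_le_iff₀ hx]; linarith [neg_abs_le (x - y)]
  rw [abs_le]; constructor <;> linarith

lemma four_log {g h k : Mat2} (hg : g.det = 1) (hh : h.det = 1) (hk : k.det = 1) {K : ℝ}
    (hgK : nsq g ≤ K) (hkK : nsq k ≤ K) :
    |Real.log (nsq (g * h * k)) - Real.log (nsq (h * k)) - Real.log (nsq (g * h))
      + Real.log (nsq h)| ≤ 8 * K ^ 4 / nsq h := by
  have n1 := two_le_nsq hg
  have n2 := two_le_nsq hh
  have n3 := two_le_nsq hk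
  have n4 : 2 ≤ nsq (h * k) := two_le_nsq (by rw [Matrix.det_mul, hh, hk, one_mul])
  have n5 : 2 ≤ nsq (g * h) := two_le_nsq (by rw [Matrix.det_mul, hh, hg, one_mul])
  have n6 : 2 ≤ nsq (g * h * k) := two_le_nsq (by simp only [Matrix.det_mul, hh, hk, hg, one_mul])
  have d := four_diff g h k
  rw [hh, abs_one, one_mul] at d
  have K2 : 2 ≤ K := n1.trans hgK
  have d' : |nsq (g * h * k) * nsq h - nsq (h * k) * nsq (g * h)| ≤ 8 * (K ^ 2 * nsq h) := by
    refine d.trans ?_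
    have : nsq g * nsq k ≤ K ^ 2 := by
      rw [sq]; exact mul_le_mul hgK hkK (by linarith) (by linarith)
    have := mul_le_mul_of_nonneg_right this (nsq_nonneg h)
    linarith
  have r1 : nsq h ≤ K * nsq (g * h) :=
    (nsq_le_left hg h).trans (mul_le_mul_of_nonneg_right hgK (by linarith))
  have r2 : nsq h ≤ K * nsq (h * k) := by
    have := (nsq_le_right hk h).trans (mul_le_mul_of_nonneg_left hkK (by linarith))
    linarith
  have r3 : nsq (g * h) ≤ K * nsq (g * h * k) := by
    have := (nsq_le_right hk (g * h)).trans (mul_le_mul_of_nonneg_left hkK (by linarith))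
    linarith
  have r4 : nsq h ≤ K ^ 2 * nsq (g * h * k) := by
    have := mul_le_mul_of_nonneg_left r3 (by linarith : 0 ≤ K)
    nlinarith
  have r5 : nsq h * nsq h ≤ K ^ 2 * (nsq (h * k) * nsq (g * h)) := by
    have := mul_le_mul r2 r1 (by linarith) (by nlinarith)
    nlinarith
  have hpos : 0 < nsq h := by linarith
  have := log_diff_le (x := nsq (g * h * k) * nsq h) (y := nsq (h * k) * nsq (g * h))
    (e := 8 * K ^ 4 / nsq h) (by positivity) (by positivity) ?_ ?_
  · rw [Real.log_mul (by linarith) (by linarith), Real.log_mul (by linarith) (by linarith)] at this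
    convert this using 2; ring
  · refine d'.trans ?_
    have e : 8 * K ^ 4 / nsq h * (nsq (g * h * k) * nsq h) = 8 * (K ^ 2 * (K ^ 2 * nsq (g * h * k))) := by
      field_simp
    rw [e]
    have := mul_le_mul_of_nonneg_left r4 (sq_nonneg K)
    linarith
  · refine d'.trans ?_
    rw [div_mul_eq_mul_div, le_div_iff₀ hpos]
    have := mul_le_mul_of_nonneg_left r5 (sq_nonneg K)
    nlinarith

lemma D_step {p : Fin κ → ℝ} (hp : ∀ i, 0 ≤ p i) (hp1 : ∑ i, p i = 1) {B : Fin κ → Mat2}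
    (hB : ∀ i, (B i).det = 1) {K : ℝ} (hK : ∀ i, nsq (B i) ≤ K) {t : ℝ} (ht1 : t ≤ 1) (n : ℕ) :
    |ell p B (n + 2) - ell p B (n + 1) - ell p B (n + 1) + ell p B n|
      ≤ 8 * K ^ 4 * Ex p B n (fun M => nsq M ^ (-t)) := by
  have E2' : ell p B (n + 2) = ∑ i, ∑ j, p i * p j *
      Ex p B n (fun h => Real.log (nsq (B j * h * B i))) := by
    unfold ell
    rw [Ex_succ]
    refine Finset.sum_congr rfl fun i _ => ?_
    rw [Ex_left, Finset.mul_sum]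
    refine Finset.sum_congr rfl fun j _ => by ring
  have E1 : ell p B (n + 1) = ∑ i, ∑ j, p i * p j *
      Ex p B n (fun h => Real.log (nsq (h * B i))) := by
    unfold ell
    rw [Ex_succ]
    refine Finset.sum_congr rfl fun i _ => ?_
    rw [← Finset.sum_mul, ← Finset.mul_sum, hp1, mul_one]
  have E1' : ell p B (n + 1) = ∑ i, ∑ j, p i * p j *
      Ex p B n (fun h => Real.log (nsq (B j * h))) := by
    unfold ell
    rw [Ex_left, Finset.sum_comm]
    refine Finset.sum_congr rfl fun i _ => ?_
    rw [← Finset.sum_mul, ← Finset.sum_mul, hp1, one_mul]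
  have E0 : ell p B n = ∑ i, ∑ j, p i * p j * Ex p B n (fun h => Real.log (nsq h)) := by
    have : ∑ i, ∑ j, p i * p j = 1 := by
      simp_rw [← Finset.mul_sum, hp1, mul_one, hp1]
    simp_rw [← Finset.sum_mul]
    rw [this, one_mul]; rfl
  have key : ell p B (n + 2) - ell p B (n + 1) - ell p B (n + 1) + ell p B n =
      ∑ i, ∑ j, p i * p j * Ex p B n (fun h => Real.log (nsq (B j * h * B i))
        - Real.log (nsq (h * B i)) - Real.log (nsq (B j * h)) + Real.log (nsq h)) := by
    conv_lhs => rw [E2', E0]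
    conv_lhs => arg 1; arg 2; rw [E1']
    conv_lhs => arg 1; arg 1; arg 2; rw [E1]
    simp_rw [← Finset.sum_sub_distrib, ← Finset.sum_add_distrib]
    refine Finset.sum_congr rfl fun i _ => Finset.sum_congr rfl fun j _ => ?_
    rw [Ex_addf, Ex_sub, Ex_sub]; ring
  have hterm : ∀ i j, |Ex p B n (fun h => Real.log (nsq (B j * h * B i))
        - Real.log (nsq (h * B i)) - Real.log (nsq (B j * h)) + Real.log (nsq h))|
        ≤ 8 * K ^ 4 * Ex p B n (fun M => nsq M ^ (-t)) := by
    intro i j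
    have hpt : ∀ h : Mat2, h.det = 1 → |Real.log (nsq (B j * h * B i))
        - Real.log (nsq (h * B i)) - Real.log (nsq (B j * h)) + Real.log (nsq h)|
        ≤ 8 * K ^ 4 * nsq h ^ (-t) := by
      intro h hh
      refine (four_log (hB j) hh (hB i) (hK j) (hK i)).trans ?_
      rw [div_eq_mul_inv, ← Real.rpow_neg_one]
      refine mul_le_mul_of_nonneg_left ?_ (by positivity)
      exact Real.rpow_le_rpow_of_exponent_le (by linarith [two_le_nsq hh]) (by linarith)
    rw [← Ex_smul, abs_le]
    constructor
    · have := Ex_mono hp hp1 hB n (fun M => -1 * (8 * K ^ 4 * nsq M ^ (-t)))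
        (fun h => Real.log (nsq (B j * h * B i))
        - Real.log (nsq (h * B i)) - Real.log (nsq (B j * h)) + Real.log (nsq h))
        (fun h hh => by linarith [(abs_le.mp (hpt h hh)).1])
      rw [Ex_smul] at this
      linarith
    · exact Ex_mono hp hp1 hB n _ _ fun h hh => (abs_le.mp (hpt h hh)).2
  rw [key]
  calc _ ≤ ∑ i, ∑ j, p i * p j * (8 * K ^ 4 * Ex p B n (fun M => nsq M ^ (-t))) := by
        refine (Finset.abs_sum_le_sum_abs _ _).trans (Finset.sum_le_sum fun i _ => ?_)
        refine (Finset.abs_sum_le_sum_abs _ _).trans (Finset.sum_le_sum fun j _ => ?_)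
        rw [abs_mul, abs_of_nonneg (mul_nonneg (hp i) (hp j))]
        exact mul_le_mul_of_nonneg_left (hterm i j) (mul_nonneg (hp i) (hp j))
    _ = _ := by
        have : ∑ i, ∑ j, p i * p j = 1 := by
          simp_rw [← Finset.mul_sum, hp1, mul_one, hp1]
        simp_rw [← Finset.sum_mul]
        rw [this, one_mul]

lemma D_close {p : Fin κ → ℝ} (hp : ∀ i, 0 ≤ p i) (hp1 : ∑ i, p i = 1) {B : Fin κ → Mat2}
    (hB : ∀ i, (B i).det = 1) {K : ℝ} (hK : ∀ i, nsq (B i) ≤ K) {t C r l : ℝ} (ht1 : t ≤ 1)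
    (hr1 : r < 1) (hmom : ∀ n, Ex p B n (fun M => nsq M ^ (-t)) ≤ C * r ^ n)
    (hl : HasLam p B l) (n : ℕ) :
    |ell p B (n + 1) - ell p B n - l| ≤ 8 * K ^ 4 * C / (1 - r) * r ^ n := by
  set D : ℕ → ℝ := fun n => ell p B (n + 1) - ell p B n with hD
  have hstep : ∀ n, dist (D n) (D (n + 1)) ≤ 8 * K ^ 4 * C * r ^ n := by
    intro n
    rw [dist_comm, Real.dist_eq]
    have := D_step hp hp1 hB hK ht1 n
    calc |D (n + 1) - D n| = |ell p B (n + 2) - ell p B (n + 1) - ell p B (n + 1) + ell p B n| := by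
          simp only [hD]; congr 1; ring
      _ ≤ _ := this
      _ ≤ 8 * K ^ 4 * (C * r ^ n) := mul_le_mul_of_nonneg_left (hmom n) (by positivity)
      _ = _ := by ring
  obtain ⟨d, hd⟩ := cauchySeq_tendsto_of_complete (cauchySeq_of_le_geometric _ _ hr1 hstep)
  have hces := hd.cesaro
  have hdl : d = l := by
    have h2 : Tendsto (fun n : ℕ => (ell p B n - ell p B 0) / n) atTop (𝓝 l) := by
      have := hl.sub (const_div_tendsto (ell p B 0))
      rw [sub_zero] at this
      refine this.congr fun n => by ring
    refine tendsto_nhds_unique (hces.congr fun n => ?_) h2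
    rw [hD, Finset.sum_range_sub, div_eq_inv_mul]
  have := dist_le_of_le_geometric_of_tendsto r _ hr1 hstep hd n
  rw [Real.dist_eq, hdl] at this
  calc _ ≤ _ := this
    _ = _ := by ring

end step1

end part3

section part4
open MeasureTheory

section step2
open Filter Topology
variable {κ : ℕ}

lemma nsq_add_le (N X : Mat2) : nsq (N + X) ≤ 2 * nsq N + 2 * nsq X := by
  unfold nsq; simp only [Matrix.add_apply]
  nlinarith [sq_nonneg (N 0 0 - X 0 0), sq_nonneg (N 0 1 - X 0 1), sq_nonneg (N 1 0 - X 1 0),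
    sq_nonneg (N 1 1 - X 1 1)]

lemma log_nsq_le {M N : Mat2} (hM : M.det = 1) (hN : N.det = 1) {s : ℝ} (hs : 0 ≤ s)
    (h : nsq (M - N) ≤ s ^ 2) : Real.log (nsq M) ≤ Real.log (nsq N) + 2 * s := by
  have n1 := two_le_nsq hM
  have n2 := two_le_nsq hN
  set r := Real.sqrt (nsq N) with hr
  have hr2 : r ^ 2 = nsq N := Real.sq_sqrt (by linarith)
  have hr1 : 1 ≤ r := by rw [hr, Real.one_le_sqrt]; linarith
  have hin : N 0 0 * (M 0 0 - N 0 0) + N 0 1 * (M 0 1 - N 0 1) + N 1 0 * (M 1 0 - N 1 0)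
      + N 1 1 * (M 1 1 - N 1 1) ≤ r * s := by
    refine le_of_abs_le (abs_le_of_sq_le_sq ?_ (by positivity))
    rw [mul_pow, hr2]
    refine le_trans ?_ (mul_le_mul_of_nonneg_left h (by linarith))
    unfold nsq; simp only [Matrix.sub_apply]
    generalize M 0 0 - N 0 0 = x
    generalize M 0 1 - N 0 1 = y
    generalize M 1 0 - N 1 0 = z
    generalize M 1 1 - N 1 1 = w
    nlinarith [sq_nonneg (N 0 0 * y - N 0 1 * x), sq_nonneg (N 0 0 * z - N 1 0 * x),
      sq_nonneg (N 0 0 * w - N 1 1 * x), sq_nonneg (N 0 1 * z - N 1 0 * y),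
      sq_nonneg (N 0 1 * w - N 1 1 * y), sq_nonneg (N 1 0 * w - N 1 1 * z)]
  have hle : nsq M ≤ (r + s) ^ 2 := by
    have e : nsq M = nsq N + nsq (M - N) + 2 * (N 0 0 * (M 0 0 - N 0 0) + N 0 1 * (M 0 1 - N 0 1)
      + N 1 0 * (M 1 0 - N 1 0) + N 1 1 * (M 1 1 - N 1 1)) := by
      unfold nsq; simp only [Matrix.sub_apply]; ring
    rw [e]; nlinarith
  have h1 : Real.log (nsq M) ≤ 2 * Real.log (r + s) := by
    have := Real.log_le_log (by linarith) hle
    rwa [Real.log_pow] at this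
  have h2 : Real.log (nsq N) = 2 * Real.log r := by rw [← hr2, Real.log_pow]; norm_num
  have h3 : Real.log (r + s) ≤ Real.log r + s := by
    have h4 := Real.log_le_sub_one_of_pos (div_pos (by linarith : 0 < r + s) (by linarith : 0 < r))
    rw [Real.log_div (by linarith) (by linarith)] at h4
    have : (r + s) / r - 1 ≤ s := by
      rw [sub_le_iff_le_add, div_le_iff₀ (by linarith)]; nlinarith
    linarith
  linarith

lemma ell_lip {p : Fin κ → ℝ} (hp : ∀ i, 0 ≤ p i) (hp1 : ∑ i, p i = 1) {B C : Fin κ → Mat2}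
    (hB : ∀ i, (B i).det = 1) (hC : ∀ i, (C i).det = 1) {K H : ℝ} (hK : ∀ i, nsq (B i) ≤ K)
    (hK' : ∀ i, nsq (C i) ≤ K) (hK1 : 1 ≤ K) (hH : 0 ≤ H) (hH2 : 6 * K ≤ H ^ 2) {δ : ℝ} (hδ : 0 ≤ δ)
    (hd : ∀ i, nsq (B i - C i) ≤ δ ^ 2) (n : ℕ) :
    ell p B n ≤ ell p C n + 2 * (H ^ n * δ) := by
  unfold ell
  refine Ex_rel hp hp1 B C (fun n M N => M.det = 1 ∧ N.det = 1 ∧ nsq N ≤ 2 * K ^ n ∧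
    nsq (M - N) ≤ (H ^ n * δ) ^ 2) ?_ ?_ n _ _ _ ?_
  · refine ⟨by simp, by simp, ?_, ?_⟩
    · simp [nsq]; norm_num
    · simp [nsq]; positivity
  · rintro n M N i ⟨h1, h2, h3, h4⟩
    refine ⟨by rw [Matrix.det_mul, h1, hB, one_mul], by rw [Matrix.det_mul, h2, hC, one_mul], ?_, ?_⟩
    · calc _ ≤ nsq N * nsq (C i) := nsq_mul_le _ _
        _ ≤ (2 * K ^ n) * K := mul_le_mul h3 (hK' i) (nsq_nonneg _) (by positivity)
        _ = _ := by ring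
    · have e : M * B i - N * C i = (M - N) * B i + N * (B i - C i) := by
        rw [sub_mul, mul_sub]; abel
      rw [e]
      refine (nsq_add_le _ _).trans ?_
      have a1 : nsq ((M - N) * B i) ≤ (H ^ n * δ) ^ 2 * K :=
        (nsq_mul_le _ _).trans (mul_le_mul h4 (hK i) (nsq_nonneg _) (by positivity))
      have a2 : nsq (N * (B i - C i)) ≤ (2 * K ^ n) * δ ^ 2 :=
        (nsq_mul_le _ _).trans (mul_le_mul h3 (hd i) (nsq_nonneg _) (by positivity))
      have a3 : K ^ n ≤ (H ^ 2) ^ n := pow_le_pow_left₀ (by linarith) (by linarith) n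
      have a4 : K ^ n * δ ^ 2 ≤ (H ^ n * δ) ^ 2 := by
        rw [mul_pow, ← pow_mul, mul_comm n 2, pow_mul]
        exact mul_le_mul_of_nonneg_right a3 (sq_nonneg δ)
      have a5 : (H ^ (n + 1) * δ) ^ 2 = (H ^ n * δ) ^ 2 * H ^ 2 := by ring
      rw [a5]
      have a6 := mul_le_mul_of_nonneg_left hH2 (sq_nonneg (H ^ n * δ))
      nlinarith [mul_le_mul_of_nonneg_left hK1 (sq_nonneg (H ^ n * δ))]
  · rintro M N ⟨h1, h2, -, h4⟩
    exact log_nsq_le h1 h2 (by positivity) h4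

lemma ell_lip_abs {p : Fin κ → ℝ} (hp : ∀ i, 0 ≤ p i) (hp1 : ∑ i, p i = 1) {B C : Fin κ → Mat2}
    (hB : ∀ i, (B i).det = 1) (hC : ∀ i, (C i).det = 1) {K H : ℝ} (hK : ∀ i, nsq (B i) ≤ K)
    (hK' : ∀ i, nsq (C i) ≤ K) (hK1 : 1 ≤ K) (hH : 0 ≤ H) (hH2 : 6 * K ≤ H ^ 2) {δ : ℝ} (hδ : 0 ≤ δ)
    (hd : ∀ i, nsq (B i - C i) ≤ δ ^ 2) (n : ℕ) :
    |ell p B n - ell p C n| ≤ 2 * (H ^ n * δ) := by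
  have hd' : ∀ i, nsq (C i - B i) ≤ δ ^ 2 := by
    intro i; refine le_trans (le_of_eq ?_) (hd i)
    unfold nsq; simp only [Matrix.sub_apply]; ring
  have h1 := ell_lip hp hp1 hB hC hK hK' hK1 hH hH2 hδ hd n
  have h2 := ell_lip hp hp1 hC hB hK' hK hK1 hH hH2 hδ hd' n
  rw [abs_le]; constructor <;> linarith

/-- The scalar optimization. -/
lemma optimize {H r C : ℝ} (hH : 1 < H) (hr : 0 < r) (hr1 : r < 1) (hC : 0 ≤ C) :
    ∃ C' α : ℝ, 0 < C' ∧ 0 < α ∧ ∀ x y : ℝ, 0 ≤ x →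
      (∀ n : ℕ, y ≤ C * r ^ n + C * H ^ n * Real.exp (-x)) → y ≤ C' * Real.exp (-α * x) := by
  have hlH : 0 < Real.log H := Real.log_pos hH
  have hlr : Real.log r < 0 := Real.log_neg hr hr1
  set a := -Real.log r / (2 * Real.log H) with ha
  have hapos : 0 < a := div_pos (by linarith) (by linarith)
  refine ⟨C * r⁻¹ + C + 1, min a (1 / 2), by positivity, by positivity, ?_⟩
  intro x y hx h
  set n := ⌊x / (2 * Real.log H)⌋₊ with hn
  have hn1 : (n : ℝ) ≤ x / (2 * Real.log H) := Nat.floor_le (by positivity)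
  have hn2 : x / (2 * Real.log H) < n + 1 := Nat.lt_floor_add_one _
  have hHn : H ^ n ≤ Real.exp (x / 2) := by
    rw [← Real.exp_log (by linarith : 0 < H), ← Real.exp_nat_mul]
    apply Real.exp_le_exp.mpr
    rw [le_div_iff₀ (by linarith)] at hn1
    linarith
  have hrn : r ^ n ≤ r⁻¹ * Real.exp (-a * x) := by
    have e : r⁻¹ * Real.exp (-a * x) = Real.exp (-Real.log r - a * x) := by
      rw [sub_eq_add_neg, Real.exp_add, Real.exp_neg, Real.exp_log hr]; ring_nf
    have e2 : r ^ n = Real.exp (n * Real.log r) := by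
      rw [Real.exp_nat_mul, Real.exp_log hr]
    rw [e, e2]
    apply Real.exp_le_exp.mpr
    have : a * x = -Real.log r * (x / (2 * Real.log H)) := by rw [ha]; ring
    rw [this]
    nlinarith
  have hm1 : Real.exp (-a * x) ≤ Real.exp (-(min a (1 / 2)) * x) := by
    apply Real.exp_le_exp.mpr
    nlinarith [min_le_left a (1 / 2)]
  have hm2 : Real.exp (-(1 / 2) * x) ≤ Real.exp (-(min a (1 / 2)) * x) := by
    apply Real.exp_le_exp.mpr
    nlinarith [min_le_right a (1 / 2)]
  have h3 : H ^ n * Real.exp (-x) ≤ Real.exp (-(1 / 2) * x) := by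
    calc _ ≤ Real.exp (x / 2) * Real.exp (-x) :=
          mul_le_mul_of_nonneg_right hHn (Real.exp_pos _).le
      _ = _ := by rw [← Real.exp_add]; congr 1; ring
  have hri : 0 < r⁻¹ := inv_pos.mpr hr
  have he := Real.exp_pos (-(min a (1 / 2)) * x)
  calc y ≤ C * r ^ n + C * H ^ n * Real.exp (-x) := h n
    _ ≤ C * (r⁻¹ * Real.exp (-(min a (1 / 2)) * x)) + C * Real.exp (-(min a (1 / 2)) * x) := by
        refine add_le_add (mul_le_mul_of_nonneg_left (hrn.trans ?_) hC) ?_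
        · exact mul_le_mul_of_nonneg_left hm1 hri.le
        · rw [mul_assoc]; exact mul_le_mul_of_nonneg_left (h3.trans hm2) hC
    _ ≤ _ := by nlinarith

lemma tdist_le {B C : Fin κ → SL2} (i : Fin κ) :
    opNorm ((B i : Mat2) - (C i : Mat2)) ≤ tdist B C :=
  le_ciSup (f := fun i => opNorm ((B i : Mat2) - (C i : Mat2))) (Set.finite_range _).bddAbove i

lemma tdist_nonneg (B C : Fin κ → SL2) : 0 ≤ tdist B C :=
  Real.iSup_nonneg fun _ => opNorm_nonneg' _

lemma nsq_tdist {B C : Fin κ → SL2} (i : Fin κ) :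
    nsq ((B i : Mat2) - (C i : Mat2)) ≤ (2 * tdist B C) ^ 2 := by
  have h1 := nsq_le_opNorm ((B i : Mat2) - (C i : Mat2))
  have h2 := pow_le_pow_left₀ (opNorm_nonneg' _) (tdist_le (B := B) (C := C) i) 2
  nlinarith [sq_nonneg (tdist B C)]

/-- Reduction of the main theorem to a uniform moment bound. -/
lemma reduction (hκ : 2 ≤ κ) {p : Fin κ → ℝ} (hp : ∀ i, 0 ≤ p i) (hp1 : ∑ i, p i = 1)
    (A : Fin κ → SL2) {ε0 t C r : ℝ} (hε0 : 0 < ε0) (ht1 : t ≤ 1) (hC : 0 ≤ C) (hr : 0 < r)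
    (hr1 : r < 1)
    (hmom : ∀ B : Fin κ → SL2, tdist A B < ε0 → ∀ n,
      Ex p (fun i => (B i : Mat2)) n (fun M => nsq M ^ (-t)) ≤ C * r ^ n) :
    ∃ ε C α β : ℝ, 0 < ε ∧ 0 < C ∧ 0 < α ∧ 0 < β ∧
      ∀ B₁ B₂ : Fin κ → SL2, tdist A B₁ < ε → tdist A B₂ < ε → B₁ ≠ B₂ →
        |lyapLC p B₁ - lyapLC p B₂| ≤
          C * Real.exp (-α * (Real.log (1 / tdist B₁ B₂)) ^ β) := by
  have : Nonempty (Fin κ) := ⟨⟨0, by omega⟩⟩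
  -- norm bound
  obtain ⟨K, hK1, hKA⟩ : ∃ K : ℝ, 1 ≤ K ∧ ∀ B : Fin κ → SL2, tdist A B < 1 / 4 →
      ∀ i, nsq (B i : Mat2) ≤ K := by
    refine ⟨2 * (∑ i, nsq (A i : Mat2)) + 2, ?_, ?_⟩
    · have : 0 ≤ ∑ i, nsq (A i : Mat2) := Finset.sum_nonneg fun i _ => nsq_nonneg _
      linarith
    · intro B hB i
      have h1 := nsq_add_le (A i : Mat2) ((B i : Mat2) - (A i : Mat2))
      rw [add_sub_cancel] at h1
      have h2 := nsq_tdist (B := A) (C := B) i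
      have h3 : nsq ((B i : Mat2) - (A i : Mat2)) = nsq ((A i : Mat2) - (B i : Mat2)) := by
        unfold nsq; simp only [Matrix.sub_apply]; ring
      have h4 : nsq (A i : Mat2) ≤ ∑ i, nsq (A i : Mat2) :=
        Finset.single_le_sum (f := fun i => nsq (A i : Mat2)) (fun i _ => nsq_nonneg _)
          (Finset.mem_univ i)
      have h5 := tdist_nonneg A B
      nlinarith
  set H := 6 * K with hH
  have hH1 : 1 < H := by linarith
  set C1 := 8 * K ^ 4 * C / (1 - r) with hC1
  have hC1n : 0 ≤ C1 := div_nonneg (by positivity) (by linarith)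
  obtain ⟨C', α, hC', hα, hopt⟩ := optimize (H := H) (r := r) (C := C1 + 8 * H) hH1 hr hr1
    (by positivity)
  refine ⟨min ε0 (1 / 4), C', α, 1, by positivity, hC', hα, one_pos, ?_⟩
  intro B₁ B₂ h1 h2 hne
  have h1a := lt_of_lt_of_le h1 (min_le_left _ _)
  have h1b := lt_of_lt_of_le h1 (min_le_right _ _)
  have h2a := lt_of_lt_of_le h2 (min_le_left _ _)
  have h2b := lt_of_lt_of_le h2 (min_le_right _ _)
  set δ := tdist B₁ B₂ with hδ
  have hδpos : 0 < δ := by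
    rcases (tdist_nonneg B₁ B₂).lt_or_eq with h | h
    · exact h
    · exfalso; apply hne
      funext i
      have h3 := nsq_tdist (B := B₁) (C := B₂) i
      rw [← h] at h3
      have h4 : nsq ((B₁ i : Mat2) - (B₂ i : Mat2)) ≤ 0 := by simpa using h3
      unfold nsq at h4
      simp only [Matrix.sub_apply] at h4
      apply Subtype.ext
      ext a b
      have := sq_nonneg ((B₁ i : Mat2) 0 0 - (B₂ i : Mat2) 0 0)
      have := sq_nonneg ((B₁ i : Mat2) 0 1 - (B₂ i : Mat2) 0 1)
      have := sq_nonneg ((B₁ i : Mat2) 1 0 - (B₂ i : Mat2) 1 0)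
      have := sq_nonneg ((B₁ i : Mat2) 1 1 - (B₂ i : Mat2) 1 1)
      fin_cases a <;> fin_cases b <;> apply sub_eq_zero.mp <;>
        refine pow_eq_zero_iff (two_ne_zero) |>.mp ?_ <;>
        simp only [Fin.zero_eta, Fin.mk_one, Fin.isValue] <;> linarith
  have hδ1 : δ < 1 := by
    refine lt_of_le_of_lt (ciSup_le fun i => ?_) (by norm_num : (1 / 2 : ℝ) < 1)
    have a1 := tdist_le (B := A) (C := B₁) i
    have a2 := tdist_le (B := A) (C := B₂) i
    have e : (B₁ i : Mat2) - (B₂ i : Mat2) = ((A i : Mat2) - B₂ i) - ((A i : Mat2) - B₁ i) := by abel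
    rw [e]
    unfold opNorm at a1 a2 ⊢
    rw [map_sub]
    refine (norm_sub_le _ _).trans ?_
    linarith
  have hx : 0 ≤ Real.log (1 / δ) := Real.log_nonneg (by rw [le_div_iff₀ hδpos]; linarith)
  have hexp : Real.exp (-Real.log (1 / δ)) = δ := by
    rw [Real.exp_neg, Real.exp_log (by positivity)]; simp
  rw [Real.rpow_one]
  refine hopt _ _ hx fun n => ?_
  rw [hexp]
  have hd1 := D_close hp hp1 (fun i => (B₁ i).2) (hKA B₁ h1b) ht1 hr1 (hmom B₁ h1a)
    (hasLam_lyap hp hp1 B₁) n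
  have hd2 := D_close hp hp1 (fun i => (B₂ i).2) (hKA B₂ h2b) ht1 hr1 (hmom B₂ h2a)
    (hasLam_lyap hp hp1 B₂) n
  rw [← hC1] at hd1 hd2
  have hH2 : 6 * K ≤ H ^ 2 := by nlinarith
  have hl := ell_lip_abs hp hp1 (fun i => (B₁ i).2) (fun i => (B₂ i).2) (hKA B₁ h1b) (hKA B₂ h2b)
    hK1 (by linarith) hH2 (by positivity : 0 ≤ 2 * δ) (fun i => nsq_tdist i)
  have hl1 := hl n
  have hl2 := hl (n + 1)
  rw [pow_succ] at hl2
  have hHn : 0 ≤ H ^ n * δ := by positivity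
  rw [abs_le] at *
  have hrn : 0 ≤ r ^ n := by positivity
  constructor <;> nlinarith
end step2

end part4

section part5
open MeasureTheory
variable {κ : ℕ}

/-! ### Negative moments from uniform expansion on average -/

lemma rpow_neg_le_quad {X R t : ℝ} (hX : 0 < X) (hR : |Real.log X| ≤ R) (ht : 0 ≤ t)
    (htR : t * R ≤ 1) : X ^ (-t) ≤ 1 - t * Real.log X + t ^ 2 * R ^ 2 := by
  rw [Real.rpow_def_of_pos hX]
  have h1 : |Real.log X * -t| ≤ 1 := by
    rw [abs_mul, abs_neg, abs_of_nonneg ht]; nlinarith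
  have h2 := (abs_le.1 (Real.abs_exp_sub_one_sub_id_le h1)).2
  have h3 : (Real.log X * -t) ^ 2 ≤ t ^ 2 * R ^ 2 := by
    have : Real.log X ^ 2 ≤ R ^ 2 := by rw [← sq_abs]; gcongr
    nlinarith [sq_nonneg t]
  linarith

lemma ratio_bounds {M : Mat2} (h : M.det = 1) {v : ℝ × ℝ} (hv : 0 < qf v) {L : ℝ}
    (hL : nsq M ≤ L) : L⁻¹ ≤ qf (act M v) / qf v ∧ qf (act M v) / qf v ≤ L := by
  have h2 := two_le_nsq h
  constructor
  · rw [le_div_iff₀ hv, inv_mul_le_iff₀ (by linarith)]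
    exact (qf_le_act h v).trans (mul_le_mul_of_nonneg_right hL (qf_nonneg _))
  · rw [div_le_iff₀ hv]
    exact (qf_act_le M v).trans (mul_le_mul_of_nonneg_right hL hv.le)

lemma abs_log_le_of {X L : ℝ} (hL : 0 < L) (h1 : L⁻¹ ≤ X) (h2 : X ≤ L) : |Real.log X| ≤ Real.log L := by
  have hX : 0 < X := lt_of_lt_of_le (inv_pos.2 hL) h1
  rw [abs_le]
  constructor
  · rw [← Real.log_inv]; exact Real.log_le_log (inv_pos.2 hL) h1
  · exact Real.log_le_log hX h2

/-- constants -/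
lemma pick_t (R γ : ℝ) (hR : 0 < R) (hγ : 0 < γ) : ∃ t : ℝ, 0 < t ∧ t ≤ 1 ∧ t * R ≤ 1 ∧
    t * γ ≤ 1 ∧ t ^ 2 * R ^ 2 ≤ t * γ / 2 := by
  refine ⟨min (min 1 R⁻¹) (min γ⁻¹ (γ / (2 * R ^ 2))), by positivity, ?_, ?_, ?_, ?_⟩
  · exact (min_le_left _ _).trans (min_le_left _ _)
  · calc _ ≤ R⁻¹ * R := by
          gcongr; exact (min_le_left _ _).trans (min_le_right _ _)
      _ = 1 := inv_mul_cancel₀ hR.ne'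
  · calc _ ≤ γ⁻¹ * γ := by
          gcongr; exact (min_le_right _ _).trans (min_le_left _ _)
      _ = 1 := inv_mul_cancel₀ hγ.ne'
  · set t := min (min 1 R⁻¹) (min γ⁻¹ (γ / (2 * R ^ 2)))
    have ht : 0 < t := by positivity
    have h1 : t ≤ γ / (2 * R ^ 2) := (min_le_right _ _).trans (min_le_right _ _)
    rw [le_div_iff₀ (by positivity)] at h1
    nlinarith

def uu (p : Fin κ → ℝ) (B : Fin κ → Mat2) (n : ℕ) (v : ℝ × ℝ) : ℝ :=
  Ex p B n (fun M => Real.log (qf (act M v)))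

/-- Uniform expansion on average. -/
def UEx (p : Fin κ → ℝ) (N : ℕ) (γ K : ℝ) (B : Fin κ → Mat2) : Prop :=
  (∀ i, (B i).det = 1) ∧ (∀ i, nsq (B i) ≤ K) ∧
  ∀ v, 0 < qf v → ∃ n, 1 ≤ n ∧ n ≤ N ∧ Real.log (qf v) + γ ≤ uu p B n v

lemma moment_of_UEx {p : Fin κ → ℝ} (hp : ∀ i, 0 ≤ p i) (hp1 : ∑ i, p i = 1) {N : ℕ} {γ K : ℝ}
    (hγ : 0 < γ) (hK : 1 ≤ K) :
    ∃ t C r : ℝ, 0 < t ∧ t ≤ 1 ∧ 0 ≤ C ∧ 0 < r ∧ r < 1 ∧ ∀ B, UEx p N γ K B →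
      ∀ n v, 0 < qf v → Ex p B n (fun M => qf (act M v) ^ (-t)) ≤ C * r ^ n * qf v ^ (-t) := by
  set L : ℝ := 2 * K ^ N with hLdef
  have hKN : 1 ≤ K ^ N := one_le_pow₀ hK
  have hL2 : 2 ≤ L := by rw [hLdef]; linarith
  have hLpos : 0 < L := by linarith
  have hR : 0 < Real.log L := Real.log_pos (by linarith)
  obtain ⟨t, ht, ht1, htR, htγ, htq⟩ := pick_t (Real.log L) γ hR hγ
  set r : ℝ := 1 - (t * γ / 2) / (N + 1) with hr
  have hN1 : (0 : ℝ) < N + 1 := by positivity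
  have htγ0 : 0 < t * γ / 2 := by positivity
  have hx : t * γ / 2 / (N + 1) ≤ 1 / 2 := by
    rw [div_le_iff₀ hN1]; have : (0 : ℝ) ≤ N := Nat.cast_nonneg N; nlinarith
  have hr0 : 0 < r := by rw [hr]; linarith
  have hr1 : r < 1 := by rw [hr]; have : 0 < t * γ / 2 / (N + 1) := by positivity
                         linarith
  have hrN : 1 - t * γ / 2 ≤ r ^ N := by
    have h := one_add_mul_le_pow (a := -(t * γ / 2 / (N + 1))) (by linarith) (N + 1)
    have h2 : r ^ (N + 1) ≤ r ^ N := pow_le_pow_of_le_one hr0.le hr1.le (Nat.le_succ N)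
    have h3 : 1 + ((N + 1 : ℕ) : ℝ) * (-(t * γ / 2 / (N + 1))) = 1 - t * γ / 2 := by
      push_cast; field_simp; ring
    rw [h3, ← sub_eq_add_neg, ← hr] at h
    linarith
  refine ⟨t, L / r ^ N, r, ht, ht1, by positivity, hr0, hr1, ?_⟩
  rintro B ⟨hB, hBK, hu⟩ n
  induction n using Nat.strong_induction_on with
  | _ n ih =>
  intro v hv
  obtain ⟨m, hm1, hmN, hm⟩ := hu v hv
  have hq : 0 < qf v ^ (-t) := Real.rpow_pos_of_pos hv _
  have hfac : ∀ M : Mat2, M.det = 1 →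
      qf (act M v) ^ (-t) = (qf (act M v) / qf v) ^ (-t) * qf v ^ (-t) := by
    intro M hM
    rw [← Real.mul_rpow (div_nonneg (qf_nonneg _) hv.le) hv.le, div_mul_cancel₀ _ hv.ne']
  have hKpow : ∀ k, k ≤ N → 2 * K ^ k ≤ L := by
    intro k hk; rw [hLdef]; have := pow_le_pow_right₀ hK hk; linarith
  by_cases hnm : n < m
  · -- small n
    have hnN : n ≤ N := by omega
    calc _ ≤ Ex p B n (fun _ => L * qf v ^ (-t)) := by
          refine Ex_mono_K hp hp1 hB hBK n _ _ fun M hM hMK => ?_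
          rw [hfac M hM]
          refine mul_le_mul_of_nonneg_right ?_ hq.le
          have hb := ratio_bounds hM hv (hMK.trans (hKpow n hnN))
          have : 0 < L⁻¹ := inv_pos.2 hLpos
          calc _ ≤ (L⁻¹) ^ (-t) := Real.rpow_le_rpow_of_nonpos this hb.1 (by linarith)
            _ = L ^ t := by rw [Real.rpow_neg this.le, Real.inv_rpow hLpos.le, inv_inv]
            _ ≤ L ^ (1 : ℝ) := Real.rpow_le_rpow_of_exponent_le (by linarith) ht1
            _ = L := Real.rpow_one L
      _ = L * qf v ^ (-t) := Ex_const hp1 B n _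
      _ ≤ _ := by
          refine mul_le_mul_of_nonneg_right ?_ hq.le
          rw [div_mul_eq_mul_div, le_div_iff₀ (by positivity)]
          exact mul_le_mul_of_nonneg_left (pow_le_pow_of_le_one hr0.le hr1.le hnN) hLpos.le
  · have hmn : m ≤ n := by omega
    have key : Ex p B m (fun M => qf (act M v) ^ (-t)) ≤ r ^ m * qf v ^ (-t) := by
      calc _ ≤ Ex p B m (fun M => (qf v ^ (-t) * (-t)) * Real.log (qf (act M v)) +
                (qf v ^ (-t)) * (1 + t * Real.log (qf v) + t ^ 2 * Real.log L ^ 2)) := by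
            refine Ex_mono_K hp hp1 hB hBK m _ _ fun M hM hMK => ?_
            have hb := ratio_bounds hM hv (hMK.trans (hKpow m hmN))
            have hpos := qf_act_pos hM hv
            have h1 := rpow_neg_le_quad (div_pos hpos hv) (abs_log_le_of hLpos hb.1 hb.2) ht.le htR
            rw [Real.log_div hpos.ne' hv.ne'] at h1
            rw [hfac M hM]
            nlinarith
        _ = qf v ^ (-t) * (1 - t * (uu p B m v - Real.log (qf v)) + t ^ 2 * Real.log L ^ 2) := by
            rw [Ex_addf, Ex_smul, Ex_const hp1]; unfold uu; ring
        _ ≤ qf v ^ (-t) * r ^ m := by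
            refine mul_le_mul_of_nonneg_left ?_ hq.le
            have h1 : r ^ N ≤ r ^ m := pow_le_pow_of_le_one hr0.le hr1.le hmN
            nlinarith
        _ = _ := mul_comm _ _
    have hsplit : n = m + (n - m) := by omega
    have hCnn : 0 ≤ L / r ^ N * r ^ (n - m) := by positivity
    calc Ex p B n (fun M => qf (act M v) ^ (-t))
        = Ex p B m (fun N' => Ex p B (n - m) (fun M => qf (act M (act N' v)) ^ (-t))) := by
          conv_lhs => rw [hsplit, Ex_add]
          simp_rw [act_mul]
      _ ≤ Ex p B m (fun N' => (L / r ^ N * r ^ (n - m)) * qf (act N' v) ^ (-t)) := by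
          refine Ex_mono hp hp1 hB m _ _ fun M hM => ?_
          exact ih (n - m) (by omega) _ (qf_act_pos hM hv)
      _ = (L / r ^ N * r ^ (n - m)) * Ex p B m (fun N' => qf (act N' v) ^ (-t)) := Ex_smul _ _ _ _ _
      _ ≤ (L / r ^ N * r ^ (n - m)) * (r ^ m * qf v ^ (-t)) := mul_le_mul_of_nonneg_left key hCnn
      _ = L / r ^ N * (r ^ m * r ^ (n - m)) * qf v ^ (-t) := by ring
      _ = _ := by rw [← pow_add, ← hsplit]

/-! ### Openness of uniform expansion -/

lemma uu_smul {p : Fin κ → ℝ} (hp : ∀ i, 0 ≤ p i) (hp1 : ∑ i, p i = 1) {B : Fin κ → Mat2}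
    (hB : ∀ i, (B i).det = 1) (n : ℕ) {v : ℝ × ℝ} (hv : 0 < qf v) {c : ℝ} (hc : c ≠ 0) :
    uu p B n (c • v) = uu p B n v + Real.log (c ^ 2) := by
  unfold uu
  rw [← Ex_const hp1 B n (Real.log (c ^ 2)), ← Ex_addf]
  refine Ex_congr hp hp1 hB n _ _ fun M hM => ?_
  rw [act_smul, qf_smul, Real.log_mul (by positivity) (qf_act_pos hM hv).ne', add_comm]

lemma qf_continuous : Continuous qf := by unfold qf; fun_prop

lemma isCompact_circle : IsCompact {v : ℝ × ℝ | qf v = 1} := by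
  refine Metric.isCompact_of_isClosed_isBounded (isClosed_eq qf_continuous continuous_const) ?_
  refine (Metric.isBounded_iff_subset_closedBall 0).2 ⟨1, fun v hv => ?_⟩
  have hv' : v.1 ^ 2 + v.2 ^ 2 = 1 := hv
  rw [mem_closedBall_zero_iff, Prod.norm_def]
  refine max_le ?_ ?_ <;> rw [Real.norm_eq_abs, ← sq_le_one_iff_abs_le_one] <;> nlinarith [sq_nonneg v.1, sq_nonneg v.2]

open Topology in
lemma UEx_open {p : Fin κ → ℝ} (hp : ∀ i, 0 ≤ p i) (hp1 : ∑ i, p i = 1)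
    (S : Set (Fin κ → Mat2)) (hS : IsCompact S) (hdet : ∀ T ∈ S, ∀ i, (T i).det = 1)
    (hexp : ∀ T ∈ S, ∀ v, 0 < qf v → ∃ n, 1 ≤ n ∧ Real.log (qf v) < uu p T n v) :
    ∃ N γ K, ∃ W ∈ 𝓝ˢ S, 0 < γ ∧ 1 ≤ K ∧ ∀ B ∈ W, (∀ i, (B i).det = 1) → UEx p N γ K B := by
  -- norm bound
  have hK : ∃ K, 1 ≤ K ∧ ∃ W ∈ 𝓝ˢ S, ∀ B ∈ W, ∀ i, nsq (B i) ≤ K := by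
    have hc : Continuous (fun B : Fin κ → Mat2 => ∑ i, nsq (B i)) := by unfold nsq; fun_prop
    obtain ⟨K, hK⟩ := hS.bddAbove_image hc.continuousOn
    refine ⟨max 1 (K + 1), le_max_left _ _, {B | ∑ i, nsq (B i) < K + 1}, ?_, ?_⟩
    · refine (isOpen_lt hc continuous_const).mem_nhdsSet.2 fun T hT => ?_
      have := hK ⟨T, hT, rfl⟩
      simp only [Set.mem_ofPred_eq] at *; linarith
    · intro B hB i
      have h1 := Finset.single_le_sum (f := fun i => nsq (B i)) (fun j _ => nsq_nonneg _) (Finset.mem_univ i)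
      have h2 : ∑ i, nsq (B i) < K + 1 := hB
      exact le_max_of_le_right (by linarith)
  obtain ⟨K, hK1, W1, hW1, hWK⟩ := hK
  have key : ∃ N : ℕ, ∃ γ : ℝ, 0 < γ ∧ ∃ W ∈ 𝓝ˢ (S ×ˢ {v : ℝ × ℝ | qf v = 1}), ∀ z ∈ W,
      ∃ n, 1 ≤ n ∧ n ≤ N ∧ γ < uu p z.1 n z.2 := by
    have hcomp := hS.prod isCompact_circle
    refine hcomp.induction_on (p := fun A => ∃ N : ℕ, ∃ γ : ℝ, 0 < γ ∧ ∃ W ∈ 𝓝ˢ A, ∀ z ∈ W,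
      ∃ n, 1 ≤ n ∧ n ≤ N ∧ γ < uu p z.1 n z.2) ?_ ?_ ?_ ?_
    · exact ⟨0, 1, one_pos, ∅, by simp, by simp⟩
    · rintro A A' hAA ⟨N, γ, hγ, W, hW, h⟩
      exact ⟨N, γ, hγ, W, nhdsSet_mono hAA hW, h⟩
    · rintro A A' ⟨N, γ, hγ, W, hW, h⟩ ⟨N', γ', hγ', W', hW', h'⟩
      refine ⟨max N N', min γ γ', lt_min hγ hγ', W ∪ W', ?_, ?_⟩
      · rw [nhdsSet_union]
        exact ⟨Filter.mem_of_superset hW Set.subset_union_left,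
          Filter.mem_of_superset hW' Set.subset_union_right⟩
      · rintro z (hz | hz)
        · obtain ⟨n, h1, h2, h3⟩ := h z hz
          exact ⟨n, h1, h2.trans (le_max_left _ _), (min_le_left _ _).trans_lt h3⟩
        · obtain ⟨n, h1, h2, h3⟩ := h' z hz
          exact ⟨n, h1, h2.trans (le_max_right _ _), (min_le_right _ _).trans_lt h3⟩
    · rintro ⟨T, v⟩ ⟨hT, hv⟩
      have hv1 : qf v = 1 := hv
      obtain ⟨n, hn1, hn⟩ := hexp T hT v (by rw [hv1]; exact one_pos)
      rw [hv1, Real.log_one] at hn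
      have hcont : ContinuousAt (fun z : (Fin κ → Mat2) × (ℝ × ℝ) => uu p z.1 n z.2) (T, v) := by
        unfold uu
        refine Ex_continuousAt p (fun z : (Fin κ → Mat2) × (ℝ × ℝ) => z.1) (T, v) ?_ (hdet T hT) n
          (fun z M => Real.log (qf (act M z.2))) ?_
        · intro i; fun_prop
        · intro M hM
          refine ContinuousAt.log ?_ (qf_act_pos hM (by rw [hv1]; exact one_pos)).ne'
          unfold qf act; fun_prop
      have hev := hcont.eventually (lt_mem_nhds (show uu p T n v / 2 < uu p T n v by linarith))
      obtain ⟨O, hOs, hO, hTO⟩ := mem_nhds_iff.1 hev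
      refine ⟨O, mem_nhdsWithin_of_mem_nhds (hO.mem_nhds hTO), n, uu p T n v / 2, by linarith, O,
        hO.mem_nhdsSet_self, fun z hz => ⟨n, hn1, le_rfl, hOs hz⟩⟩
  obtain ⟨N, γ, hγ, W, hW, h⟩ := key
  obtain ⟨O, hO, hSO, hOW⟩ := mem_nhdsSet_iff_exists.1 hW
  obtain ⟨U1, U2, hU1, _, hSU, hCU, hUO⟩ := generalized_tube_lemma hS isCompact_circle hO hSO
  refine ⟨N, γ, K, U1 ∩ W1, Filter.inter_mem (hU1.mem_nhdsSet.2 hSU) hW1, hγ, hK1, ?_⟩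
  rintro B ⟨hB1, hB2⟩ hBd
  refine ⟨hBd, hWK B hB2, fun v hv => ?_⟩
  set c := Real.sqrt (qf v) with hc
  have hcpos : 0 < c := Real.sqrt_pos.2 hv
  have hc2 : c ^ 2 = qf v := Real.sq_sqrt hv.le
  have hw : qf (c⁻¹ • v) = 1 := by
    rw [qf_smul, inv_pow, hc2, inv_mul_cancel₀ hv.ne']
  obtain ⟨n, h1, h2, h3⟩ := h (B, c⁻¹ • v) (hOW (hUO ⟨hB1, hCU hw⟩))
  refine ⟨n, h1, h2, ?_⟩
  simp only at h3
  rw [uu_smul hp hp1 hBd n hv (inv_ne_zero hcpos.ne'), inv_pow, hc2, Real.log_inv] at h3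
  linarith

end part5

section part6
open MeasureTheory Filter Topology
variable {κ : ℕ}

/-! ### Conjugation and monomial matrices -/

lemma nsq_one : nsq (1 : Mat2) = 2 := by simp [nsq]; norm_num

lemma HasLam.conj {p : Fin κ → ℝ} (hp : ∀ i, 0 ≤ p i) (hp1 : ∑ i, p i = 1) {T : Fin κ → Mat2}
    (hT : ∀ i, (T i).det = 1) {l : ℝ} (hl : HasLam p T l) {P Q : Mat2} (hPQ : P * Q = 1) :
    HasLam p (fun i => P * T i * Q) l := by
  have hQP : Q * P = 1 := mul_eq_one_comm.mp hPQ
  set c := nsq P * nsq Q with hc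
  have hc2 : 2 ≤ c := by rw [← nsq_one, ← hPQ]; exact nsq_mul_le P Q
  have hP0 := nsq_nonneg P
  have hQ0 := nsq_nonneg Q
  have hbd : ∀ M : Mat2, M.det = 1 →
      Real.log (nsq (P * M * Q)) ≤ Real.log (nsq M) + Real.log c ∧
      Real.log (nsq M) ≤ Real.log (nsq (P * M * Q)) + Real.log c := by
    intro M hM
    have hM2 := two_le_nsq hM
    have h1 : nsq (P * M * Q) ≤ nsq M * c := by
      calc _ ≤ nsq (P * M) * nsq Q := nsq_mul_le _ _
        _ ≤ (nsq P * nsq M) * nsq Q := mul_le_mul_of_nonneg_right (nsq_mul_le _ _) hQ0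
        _ = _ := by rw [hc]; ring
    have hdet : (P * M * Q).det = 1 := by
      rw [Matrix.det_mul, Matrix.det_mul, hM, mul_one, ← Matrix.det_mul, hPQ, Matrix.det_one]
    have hM2' := two_le_nsq hdet
    have h2 : nsq M ≤ nsq (P * M * Q) * c := by
      calc nsq M = nsq (Q * (P * M * Q) * P) := by
            congr 1
            calc M = (Q * P) * M * (Q * P) := by rw [hQP, one_mul, mul_one]
              _ = _ := by simp only [mul_assoc]
        _ ≤ nsq (Q * (P * M * Q)) * nsq P := nsq_mul_le _ _
        _ ≤ (nsq Q * nsq (P * M * Q)) * nsq P := mul_le_mul_of_nonneg_right (nsq_mul_le _ _) hP0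
        _ = _ := by rw [hc]; ring
    constructor
    · rw [← Real.log_mul (by linarith) (by linarith)]
      exact Real.log_le_log (by linarith) h1
    · rw [← Real.log_mul (by linarith) (by linarith)]
      exact Real.log_le_log (by linarith) h2
  refine HasLam.of_close (C := Real.log c) _ hl fun n => ?_
  have e : ell p (fun i => P * T i * Q) n = Ex p T n (fun M => Real.log (nsq (P * M * Q))) := by
    unfold ell; rw [Ex_conj p T P Q hPQ]
  rw [e, abs_le]
  unfold ell
  constructor
  · have := Ex_mono hp hp1 hT n _ _ (fun M hM => (hbd M hM).2)
    rw [Ex_addf, Ex_const hp1] at this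
    linarith
  · have := Ex_mono hp hp1 hT n _ _ (fun M hM => (hbd M hM).1)
    rw [Ex_addf, Ex_const hp1] at this
    linarith

def Mono (M : Mat2) : Prop :=
  (M 0 1 = 0 ∧ M 1 0 = 0 ∧ M 0 0 * M 1 1 = 1) ∨ (M 0 0 = 0 ∧ M 1 1 = 0 ∧ M 0 1 * M 1 0 = -1)

def gm (M : Mat2) : ℝ := Real.log |M 0 0 + M 1 0|

lemma Mono_one : Mono 1 := by left; simp

lemma Mono_det {M : Mat2} (h : Mono M) : M.det = 1 := by
  rw [Matrix.det_fin_two]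
  rcases h with ⟨a, b, c⟩ | ⟨a, b, c⟩ <;> rw [a, b] <;> linarith

lemma Mono_mul {M T : Mat2} (hM : Mono M) (hT : Mono T) : Mono (M * T) := by
  unfold Mono
  rw [mul00, mul01, mul10, mul11]
  rcases hM with ⟨a, b, c⟩ | ⟨a, b, c⟩ <;> rcases hT with ⟨a', b', c'⟩ | ⟨a', b', c'⟩ <;>
    rw [a, b, a', b']
  · left; exact ⟨by ring, by ring, by linear_combination c * T 0 0 * T 1 1 + c'⟩
  · right; exact ⟨by ring, by ring, by linear_combination c * T 0 1 * T 1 0 + c'⟩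
  · right; exact ⟨by ring, by ring, by linear_combination c * T 0 0 * T 1 1 - c'⟩
  · left; exact ⟨by ring, by ring, by linear_combination c * T 0 1 * T 1 0 - c'⟩

def etaT (T : Mat2) : ℝ := if T 0 1 = 0 then 1 else -1

lemma etaT_sq (T : Mat2) : etaT T ^ 2 = 1 := by unfold etaT; split_ifs <;> norm_num

lemma gm_mul {M T : Mat2} (hM : Mono M) (hT : Mono T) : gm (M * T) = gm T + etaT T * gm M := by
  unfold gm etaT
  rw [mul00, mul10]
  rcases hT with ⟨a', b', c'⟩ | ⟨a', b', c'⟩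
  · rw [if_pos a', b']
    have h0 : T 0 0 ≠ 0 := by rintro h; rw [h] at c'; norm_num at c'
    have h1 : M 0 0 + M 1 0 ≠ 0 := by
      rcases hM with ⟨a, b, c⟩ | ⟨a, b, c⟩
      · rw [b]; rintro h; have : M 0 0 = 0 := by linarith
        rw [this] at c; norm_num at c
      · rw [a]; rintro h; have : M 1 0 = 0 := by linarith
        rw [this] at c; norm_num at c
    have : M 0 0 * T 0 0 + M 0 1 * 0 + (M 1 0 * T 0 0 + M 1 1 * 0) = T 0 0 * (M 0 0 + M 1 0) := by ring
    rw [this, abs_mul, Real.log_mul (abs_ne_zero.2 h0) (abs_ne_zero.2 h1)]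
    simp
  · have h01 : T 0 1 ≠ 0 := by rintro h; rw [h] at c'; norm_num at c'
    have h10 : T 1 0 ≠ 0 := by rintro h; rw [h] at c'; norm_num at c'
    rw [if_neg h01, a']
    rcases hM with ⟨a, b, c⟩ | ⟨a, b, c⟩
    · have h00 : M 0 0 ≠ 0 := by rintro h; rw [h] at c; norm_num at c
      have h11 : M 1 1 = (M 0 0)⁻¹ := by field_simp; linarith
      rw [a, b, h11]
      simp [abs_mul, Real.log_mul, h10, h00, add_comm]
    · have h00 : M 1 0 ≠ 0 := by rintro h; rw [h] at c; norm_num at c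
      have h11 : M 0 1 = -(M 1 0)⁻¹ := by field_simp; linarith
      rw [a, b, h11]
      simp [abs_mul, Real.log_mul, h10, h00, add_comm]

lemma log_nsq_mono {M : Mat2} (hM : Mono M) : Real.log (nsq M) ≤ Real.log 2 + 2 * |gm M| := by
  have key : ∀ a b : ℝ, a * b = 1 → Real.log (a ^ 2 + b ^ 2) ≤ Real.log 2 + 2 * |Real.log (|a|)| := by
    intro a b hab
    have ha : a ≠ 0 := by rintro rfl; simp at hab
    have ha' : 0 < |a| := abs_pos.2 ha
    have hb : b = a⁻¹ := by field_simp; linarith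
    have h1 : a ^ 2 ≤ Real.exp (2 * |Real.log (|a|)|) := by
      calc a ^ 2 = Real.exp (2 * Real.log |a|) := by
            rw [two_mul, Real.exp_add, Real.exp_log ha', ← sq, sq_abs]
        _ ≤ _ := Real.exp_le_exp.2 (by linarith [le_abs_self (Real.log |a|)])
    have h2 : b ^ 2 ≤ Real.exp (2 * |Real.log (|a|)|) := by
      calc b ^ 2 = Real.exp (-(2 * Real.log |a|)) := by
            rw [two_mul, Real.exp_neg, Real.exp_add, Real.exp_log ha', ← sq, sq_abs, hb, inv_pow]
        _ ≤ _ := Real.exp_le_exp.2 (by linarith [neg_abs_le (Real.log |a|)])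
    rw [← Real.log_exp (2 * |Real.log (|a|)|), ← Real.log_mul (by norm_num) (Real.exp_ne_zero _)]
    exact Real.log_le_log (by positivity) (by linarith)
  unfold nsq gm
  rcases hM with ⟨a, b, c⟩ | ⟨a, b, c⟩
  · have := key _ _ c
    rw [a, b]; simpa using this
  · have := key (M 1 0) (-(M 0 1)) (by linarith)
    rw [a, b]
    simp only [neg_sq] at this
    rw [add_comm] at this
    simpa using this

lemma Ex_congr_mono {p : Fin κ → ℝ} (hp : ∀ i, 0 ≤ p i) (hp1 : ∑ i, p i = 1) {T : Fin κ → Mat2}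
    (hT : ∀ i, Mono (T i)) (n : ℕ) (f g : Mat2 → ℝ) (h : ∀ M : Mat2, Mono M → f M = g M) :
    Ex p T n f = Ex p T n g :=
  le_antisymm
    (Ex_mono_P hp hp1 T (fun _ M => Mono M) Mono_one (fun _ _ i hM => Mono_mul hM (hT i)) n f g
      fun M hM => (h M hM).le)
    (Ex_mono_P hp hp1 T (fun _ M => Mono M) Mono_one (fun _ _ i hM => Mono_mul hM (hT i)) n g f
      fun M hM => (h M hM).ge)

lemma zero_mean {p : Fin κ → ℝ} (hp : ∀ i, 0 ≤ p i) (hp1 : ∑ i, p i = 1) {T : Fin κ → Mat2}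
    (hT : ∀ i, Mono (T i)) (h0 : ∑ i, p i * gm (T i) = 0) {l : ℝ}
    (hl : ∀ n : ℕ, n * l ≤ ell p T n) : l ≤ 0 := by
  have hE1 : ∀ n, Ex p T n gm = 0 := by
    intro n
    induction n with
    | zero => simp [Ex, gm]
    | succ n ih =>
      rw [Ex_succ]
      have : ∀ i, Ex p T n (fun M => gm (M * T i)) = gm (T i) := by
        intro i
        rw [Ex_congr_mono hp hp1 hT n _ (fun M => gm (T i) + etaT (T i) * gm M)
          (fun M hM => gm_mul hM (hT i)), Ex_addf, Ex_const hp1, Ex_smul, ih]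
        ring
      simp_rw [this]; exact h0
  set s := ∑ i, p i * gm (T i) ^ 2 with hs
  have hs0 : 0 ≤ s := Finset.sum_nonneg fun i _ => mul_nonneg (hp i) (sq_nonneg _)
  have hE2 : ∀ n : ℕ, Ex p T n (fun M => gm M ^ 2) = n * s := by
    intro n
    induction n with
    | zero => simp [Ex, gm]
    | succ n ih =>
      rw [Ex_succ]
      have : ∀ i, Ex p T n (fun M => gm (M * T i) ^ 2) = gm (T i) ^ 2 + n * s := by
        intro i
        rw [Ex_congr_mono hp hp1 hT n _
          (fun M => gm (T i) ^ 2 + ((2 * gm (T i) * etaT (T i)) * gm M + 1 * gm M ^ 2))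
          (fun M hM => by rw [gm_mul hM (hT i)]; linear_combination gm M ^ 2 * etaT_sq (T i)),
          Ex_addf, Ex_const hp1, Ex_lin, ih, hE1]
        ring
      simp_rw [this, mul_add, Finset.sum_add_distrib, ← Finset.sum_mul, hp1]
      push_cast; ring
  have hub : ∀ (n : ℕ) (τ : ℝ), 0 < τ → ell p T n ≤ Real.log 2 + τ + n * s / τ := by
    intro n τ hτ
    calc ell p T n ≤ Ex p T n (fun M => (Real.log 2 + τ) + (1 / τ) * gm M ^ 2) := by
          refine Ex_mono_P hp hp1 T (fun _ M => Mono M) Mono_one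
            (fun _ _ i hM => Mono_mul hM (hT i)) n _ _ fun M hM => ?_
          have h1 := log_nsq_mono hM
          have h2 : 2 * |gm M| ≤ τ + 1 / τ * gm M ^ 2 := by
            rw [← sq_abs (gm M)]
            have : τ + 1 / τ * |gm M| ^ 2 - 2 * |gm M| = (τ - |gm M|) ^ 2 / τ := by
              field_simp; ring
            have h3 : 0 ≤ (τ - |gm M|) ^ 2 / τ := by positivity
            linarith
          linarith
      _ = _ := by rw [Ex_addf, Ex_const hp1, Ex_smul, hE2]; ring
  by_contra hc
  push Not at hc
  obtain ⟨n, hn⟩ := exists_nat_gt ((Real.log 2 + 2 * s / l) * (2 / l))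
  have hl2 : 0 < Real.log 2 := Real.log_pos (by norm_num)
  have hn0 : (0 : ℝ) < n := lt_of_le_of_lt (by positivity) hn
  have h1 := hl n
  have h2 := hub n (n * l / 2) (by positivity)
  have h3 : (n : ℝ) * s / (n * l / 2) = 2 * s / l := by field_simp
  rw [h3] at h2
  rw [mul_div, div_lt_iff₀ hc] at hn
  nlinarith

/-! ### Change of basis -/

def wd (v w : ℝ × ℝ) : ℝ := v.1 * w.2 - v.2 * w.1

def Pm (v w : ℝ × ℝ) : Mat2 := !![v.1, w.1; v.2, w.2]
def Qm (v w : ℝ × ℝ) : Mat2 := !![w.2 / wd v w, -w.1 / wd v w; -v.2 / wd v w, v.1 / wd v w]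

lemma Qm_Pm {v w : ℝ × ℝ} (h : wd v w ≠ 0) : Qm v w * Pm v w = 1 := by
  ext i j
  fin_cases i <;> fin_cases j
  · show (Qm v w * Pm v w) 0 0 = _
    rw [mul00]; simp [Qm, Pm]; field_simp; unfold wd; ring
  · show (Qm v w * Pm v w) 0 1 = _
    rw [mul01]; simp [Qm, Pm]; field_simp; ring
  · show (Qm v w * Pm v w) 1 0 = _
    rw [mul10]; simp [Qm, Pm]; field_simp; ring
  · show (Qm v w * Pm v w) 1 1 = _
    rw [mul11]; simp [Qm, Pm]; field_simp; unfold wd; ring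

lemma cj_entries {v w : ℝ × ℝ} (h : wd v w ≠ 0) (T : Mat2) :
    (Qm v w * T * Pm v w) 0 0 = wd (act T v) w / wd v w ∧
    (Qm v w * T * Pm v w) 0 1 = wd (act T w) w / wd v w ∧
    (Qm v w * T * Pm v w) 1 0 = wd v (act T v) / wd v w ∧
    (Qm v w * T * Pm v w) 1 1 = wd v (act T w) / wd v w := by
  simp only [mul00, mul01, mul10, mul11]
  refine ⟨?_, ?_, ?_, ?_⟩ <;> simp [Qm, Pm] <;> field_simp <;> simp [wd, act] <;> ring

lemma cj_det {P Q T : Mat2} (hPQ : P * Q = 1) (hT : T.det = 1) : (P * T * Q).det = 1 := by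
  rw [Matrix.det_mul, Matrix.det_mul, hT, mul_one, ← Matrix.det_mul, hPQ, Matrix.det_one]

lemma wd_act (M : Mat2) (v w : ℝ × ℝ) : wd (act M v) (act M w) = M.det * wd v w := by
  rw [Matrix.det_fin_two]; unfold wd act; ring

lemma par_of_wd {v w : ℝ × ℝ} (hv : 0 < qf v) (h : wd v w = 0) : ∃ c : ℝ, w = c • v := by
  refine ⟨(v.1 * w.1 + v.2 * w.2) / qf v, ?_⟩
  unfold wd at h
  have h' := hv.ne'
  ext
  · simp; field_simp; unfold qf; linear_combination -v.2 * h
  · simp; field_simp; unfold qf; linear_combination v.1 * h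

lemma qf_pos_of_wd {v w : ℝ × ℝ} (h : wd v w ≠ 0) : 0 < qf v ∧ 0 < qf w := by
  constructor <;> apply qf_pos <;> rintro rfl <;> simp [wd] at h

/-- Monomial tuples with a genuine swap have zero exponent. -/
lemma swap_case {p : Fin κ → ℝ} (hp : ∀ i, 0 < p i) (hp1 : ∑ i, p i = 1) {T : Fin κ → Mat2}
    (hT : ∀ i, Mono (T i)) {l : ℝ} (hl : HasLam p T l) (i0 : Fin κ) (hi0 : T i0 0 1 ≠ 0) :
    l ≤ 0 := by
  have hp0 : ∀ i, 0 ≤ p i := fun i => (hp i).le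
  set q := ∑ i, p i * (if T i 0 1 = 0 then (0 : ℝ) else 1) with hq
  have hqpos : 0 < q := by
    refine Finset.sum_pos' (fun i _ => mul_nonneg (hp0 i) (by split_ifs <;> norm_num))
      ⟨i0, Finset.mem_univ _, ?_⟩
    rw [if_neg hi0, mul_one]; exact hp i0
  set s := Real.exp ((∑ i, p i * gm (T i)) / q) with hs
  have hs0 : 0 < s := Real.exp_pos _
  set P : Mat2 := !![s, 0; 0, 1] with hP
  set Q : Mat2 := !![s⁻¹, 0; 0, 1] with hQ
  have hPQ : P * Q = 1 := by
    rw [hP, hQ]; ext i j; fin_cases i <;> fin_cases j <;> simp [hs0.ne']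
  have e : ∀ M : Mat2, (P * M * Q) 0 0 = M 0 0 ∧ (P * M * Q) 0 1 = s * M 0 1 ∧
      (P * M * Q) 1 0 = M 1 0 * s⁻¹ ∧ (P * M * Q) 1 1 = M 1 1 := by
    intro M
    simp only [mul00, mul01, mul10, mul11]
    refine ⟨?_, ?_, ?_, ?_⟩ <;> simp [hP, hQ] <;> field_simp
  have hmono : ∀ i, Mono (P * T i * Q) := by
    intro i
    obtain ⟨e1, e2, e3, e4⟩ := e (T i)
    unfold Mono
    rw [e1, e2, e3, e4]
    rcases hT i with ⟨a, b, c⟩ | ⟨a, b, c⟩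
    · left; rw [a, b]; exact ⟨by ring, by ring, c⟩
    · right; refine ⟨a, b, ?_⟩; rw [← c]; field_simp
  have hg : ∀ i, gm (P * T i * Q) = gm (T i) - (if T i 0 1 = 0 then (0 : ℝ) else 1) * Real.log s := by
    intro i
    obtain ⟨e1, e2, e3, e4⟩ := e (T i)
    unfold gm
    rw [e1, e3]
    rcases hT i with ⟨a, b, c⟩ | ⟨a, b, c⟩
    · rw [if_pos a, b]; simp
    · have h1 : T i 0 1 ≠ 0 := by rintro h; rw [h] at c; norm_num at c
      have h2 : T i 1 0 ≠ 0 := by rintro h; rw [h] at c; norm_num at c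
      rw [if_neg h1, a]
      simp only [zero_add, abs_mul, abs_inv, abs_of_pos hs0]
      rw [Real.log_mul (abs_ne_zero.2 h2) (inv_ne_zero hs0.ne'), Real.log_inv]
      ring
  refine zero_mean hp0 hp1 hmono ?_
    (HasLam.le hp0 hp1 (fun i => Mono_det (hmono i)) (hl.conj hp0 hp1 (fun i => Mono_det (hT i)) hPQ))
  simp_rw [hg, mul_sub, Finset.sum_sub_distrib, ← mul_assoc, ← Finset.sum_mul]
  rw [← hq, hs, Real.log_exp]
  field_simp
  ring

/-- Lower triangular tuples with zero mean have zero exponent. -/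
lemma tri_case {p : Fin κ → ℝ} (hp : ∀ i, 0 ≤ p i) (hp1 : ∑ i, p i = 1) {T : Fin κ → Mat2}
    (hT : ∀ i, (T i).det = 1) (h01 : ∀ i, T i 0 1 = 0) (h0 : ∑ i, p i * Real.log |T i 0 0| = 0)
    {l : ℝ} (hl : HasLam p T l) : l ≤ 0 := by
  set S : ℝ → Fin κ → Mat2 := fun η i => !![T i 0 0, 0; η * T i 1 0, T i 1 1] with hS
  have hd : ∀ i, T i 0 0 * T i 1 1 = 1 := by
    intro i; have := hT i; rw [Matrix.det_fin_two, h01] at this; linarith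
  have hSd : ∀ η i, (S η i).det = 1 := by
    intro η i; rw [Matrix.det_fin_two]; simp [hS, hd]
  have hmono : ∀ i, Mono (S 0 i) := by
    intro i; left; simp [hS, hd]
  have hle : ∀ η : ℝ, η ≠ 0 → ∀ n : ℕ, n * l ≤ ell p (S η) n := by
    intro η hη
    set P : Mat2 := !![1, 0; 0, η] with hP
    set Q : Mat2 := !![1, 0; 0, η⁻¹] with hQ
    have hPQ : P * Q = 1 := by
      rw [hP, hQ]; ext i j; fin_cases i <;> fin_cases j <;> simp [hη]
    have : S η = fun i => P * T i * Q := by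
      funext i; ext a b
      fin_cases a <;> fin_cases b
      · show _ = (P * T i * Q) 0 0
        simp only [mul00, mul01]; simp [hP, hQ, hS]
      · show _ = (P * T i * Q) 0 1
        simp only [mul00, mul01]; simp [hP, hQ, hS, h01]
      · show _ = (P * T i * Q) 1 0
        simp only [mul10, mul11]; simp [hP, hQ, hS]
      · show _ = (P * T i * Q) 1 1
        simp only [mul10, mul11]; simp [hP, hQ, hS]; field_simp
    rw [this]
    exact HasLam.le hp hp1 (fun i => cj_det hPQ (hT i)) (hl.conj hp hp1 hT hPQ)
  refine zero_mean hp hp1 hmono ?_ fun n => ?_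
  · have : ∀ i, gm (S 0 i) = Real.log |T i 0 0| := by intro i; simp [gm, hS]
    simp_rw [this]; exact h0
  · have hcont : ContinuousAt (fun η => ell p (S η) n) 0 := by
      unfold ell
      refine Ex_continuousAt p S 0 ?_ (hSd 0) n (fun _ M => Real.log (nsq M)) ?_
      · intro i
        refine Continuous.continuousAt ?_
        refine continuous_matrix fun a b => ?_
        fin_cases a <;> fin_cases b <;> simp [hS] <;> fun_prop
      · intro M hM
        refine ContinuousAt.log ?_ (by have := two_le_nsq hM; simp only; linarith)
        unfold nsq; fun_prop
    have ht : Tendsto (fun η => ell p (S η) n) (𝓝[≠] 0) (𝓝 (ell p (S 0) n)) :=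
      hcont.tendsto.mono_left nhdsWithin_le_nhds
    refine ge_of_tendsto ht ?_
    filter_upwards [self_mem_nhdsWithin] with η hη
    exact hle η hη n

end part6

section part7
open MeasureTheory Filter Topology
variable {κ : ℕ}

/-! ### Dichotomy: expansion on average or an invariant contracted line -/

lemma uu_succ (p : Fin κ → ℝ) (T : Fin κ → Mat2) (n : ℕ) (v : ℝ × ℝ) :
    uu p T (n + 1) v = ∑ i, p i * uu p T n (act (T i) v) := by
  unfold uu; rw [Ex_succ]; simp_rw [act_mul]

lemma uu_step {p : Fin κ → ℝ} (hp : ∀ i, 0 ≤ p i) (hp1 : ∑ i, p i = 1) {T : Fin κ → Mat2}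
    (hT : ∀ i, (T i).det = 1) {K : ℝ} (hK : ∀ i, nsq (T i) ≤ K) (hK0 : 0 < K) (n : ℕ)
    {v : ℝ × ℝ} (hv : 0 < qf v) : |uu p T (n + 1) v - uu p T n v| ≤ Real.log K := by
  have h : ∀ i, |Ex p T n (fun M => Real.log (qf (act (T i * M) v))) - uu p T n v| ≤ Real.log K := by
    intro i
    unfold uu
    rw [← Ex_sub, abs_le]
    have hb : ∀ M : Mat2, M.det = 1 →
        |Real.log (qf (act (T i * M) v)) - Real.log (qf (act M v))| ≤ Real.log K := by
      intro M hM
      have h1 := qf_act_pos hM hv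
      have h2 := ratio_bounds (hT i) h1 (hK i)
      rw [act_mul, ← Real.log_div (qf_act_pos (hT i) h1).ne' h1.ne']
      exact abs_log_le_of hK0 h2.1 h2.2
    constructor
    · rw [← Ex_const hp1 T n (-Real.log K)]
      exact Ex_mono hp hp1 hT n _ _ fun M hM => (abs_le.1 (hb M hM)).1
    · rw [← Ex_const hp1 T n (Real.log K)]
      exact Ex_mono hp hp1 hT n _ _ fun M hM => (abs_le.1 (hb M hM)).2
  have e : uu p T (n + 1) v - uu p T n v =
      ∑ i, p i * (Ex p T n (fun M => Real.log (qf (act (T i * M) v))) - uu p T n v) := by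
    simp_rw [mul_sub, Finset.sum_sub_distrib, ← Finset.sum_mul, hp1, one_mul]
    conv_lhs => unfold uu
    rw [Ex_left]; rfl
  rw [e]
  calc _ ≤ ∑ i, |p i * (Ex p T n (fun M => Real.log (qf (act (T i * M) v))) - uu p T n v)| :=
        Finset.abs_sum_le_sum_abs _ _
    _ ≤ ∑ i, p i * Real.log K := Finset.sum_le_sum fun i _ => by
        rw [abs_mul, abs_of_nonneg (hp i)]; exact mul_le_mul_of_nonneg_left (h i) (hp i)
    _ = _ := by rw [← Finset.sum_mul, hp1, one_mul]

lemma wd_ineq (M : Mat2) (v w : ℝ × ℝ) :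
    nsq M * wd v w ^ 2 ≤ 2 * (qf (act M v) * qf w + qf (act M w) * qf v) := by
  have h : ∀ a b v1 v2 w1 w2 : ℝ, (a ^ 2 + b ^ 2) * (v1 * w2 - v2 * w1) ^ 2 ≤
      2 * ((a * v1 + b * v2) ^ 2 * (w1 ^ 2 + w2 ^ 2) + (a * w1 + b * w2) ^ 2 * (v1 ^ 2 + v2 ^ 2)) := by
    intro a b v1 v2 w1 w2
    have h1 : a * (v1 * w2 - v2 * w1) = w2 * (a * v1 + b * v2) - v2 * (a * w1 + b * w2) := by ring
    have h2 : b * (v1 * w2 - v2 * w1) = v1 * (a * w1 + b * w2) - w1 * (a * v1 + b * v2) := by ring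
    have : (a ^ 2 + b ^ 2) * (v1 * w2 - v2 * w1) ^ 2 =
      (a * (v1 * w2 - v2 * w1)) ^ 2 + (b * (v1 * w2 - v2 * w1)) ^ 2 := by ring
    rw [this, h1, h2]
    generalize a * v1 + b * v2 = x
    generalize a * w1 + b * w2 = y
    nlinarith [sq_nonneg (w2 * x + v2 * y), sq_nonneg (v1 * y + w1 * x)]
  have h1 := h (M 0 0) (M 0 1) v.1 v.2 w.1 w.2
  have h2 := h (M 1 0) (M 1 1) v.1 v.2 w.1 w.2
  unfold nsq wd qf act
  simp only
  linarith

/-- for a non-parallel pair, at least one is expanded comparably to the norm -/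
lemma pair_good {v w : ℝ × ℝ} (h : wd v w ≠ 0) : ∃ c : ℝ, 0 < c ∧ ∀ M : Mat2,
    c * nsq M ≤ qf (act M v) ∨ c * nsq M ≤ qf (act M w) := by
  obtain ⟨hv, hw⟩ := qf_pos_of_wd h
  have hwd : 0 < wd v w ^ 2 := by positivity
  refine ⟨wd v w ^ 2 / (2 * (qf v + qf w)), by positivity, fun M => ?_⟩
  by_contra hc
  push Not at hc
  obtain ⟨h1, h2⟩ := hc
  rw [div_mul_eq_mul_div, lt_div_iff₀ (by positivity)] at h1 h2
  have := wd_ineq M v w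
  nlinarith

lemma three_bound {a b c : ℝ × ℝ} (hab : wd a b ≠ 0) (hbc : wd b c ≠ 0) (hac : wd a c ≠ 0) :
    ∃ C : ℝ, ∀ M : Mat2, M.det = 1 →
      (Real.log (nsq M) - Real.log (qf (act M a))) + (Real.log (nsq M) - Real.log (qf (act M b)))
      + (Real.log (nsq M) - Real.log (qf (act M c))) ≤ 2 * Real.log (nsq M) + C := by
  obtain ⟨c1, hc1, g1⟩ := pair_good hab
  obtain ⟨c2, hc2, g2⟩ := pair_good hbc
  obtain ⟨c3, hc3, g3⟩ := pair_good hac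
  have ha := (qf_pos_of_wd hab).1
  have hb := (qf_pos_of_wd hab).2
  have hc := (qf_pos_of_wd hbc).2
  refine ⟨|Real.log c1| + |Real.log c2| + |Real.log c3| + (|Real.log c1| + |Real.log c2| + |Real.log c3|)
    + (|Real.log (qf a)| + |Real.log (qf b)| + |Real.log (qf c)|), fun M hM => ?_⟩
  have hM2 := two_le_nsq hM
  have hlog : 0 ≤ Real.log (nsq M) := Real.log_nonneg (by linarith)
  have bad : ∀ v : ℝ × ℝ, 0 < qf v → Real.log (nsq M) - Real.log (qf (act M v)) ≤
      2 * Real.log (nsq M) + |Real.log (qf v)| := by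
    intro v hv
    have h1 := Real.log_le_log hv (qf_le_act hM v)
    rw [Real.log_mul (by linarith) (qf_act_pos hM hv).ne'] at h1
    linarith [neg_abs_le (Real.log (qf v))]
  have good : ∀ (v : ℝ × ℝ) (e : ℝ), 0 < e → e * nsq M ≤ qf (act M v) →
      Real.log (nsq M) - Real.log (qf (act M v)) ≤ |Real.log e| := by
    intro v e he h
    have h1 := Real.log_le_log (by positivity) h
    rw [Real.log_mul he.ne' (by linarith)] at h1
    linarith [neg_abs_le (Real.log e)]
  have b1 := bad a ha
  have b2 := bad b hb
  have b3 := bad c hc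
  have n1 := abs_nonneg (Real.log c1)
  have n2 := abs_nonneg (Real.log c2)
  have n3 := abs_nonneg (Real.log c3)
  have m1 := abs_nonneg (Real.log (qf a))
  have m2 := abs_nonneg (Real.log (qf b))
  have m3 := abs_nonneg (Real.log (qf c))
  rcases g1 M with h1 | h1 <;> rcases g2 M with h2 | h2 <;> rcases g3 M with h3 | h3 <;>
    have k1 := good _ _ hc1 h1 <;> have k2 := good _ _ hc2 h2 <;> have k3 := good _ _ hc3 h3 <;>
    linarith

lemma ultra_lim (a : ℕ → ℝ) (C : ℝ) (h : ∀ n, |a n| ≤ C) :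
    ∃ l, Tendsto a (hyperfilter ℕ : Filter ℕ) (𝓝 l) := by
  have hK : IsCompact (Set.Icc (-C) C) := isCompact_Icc
  obtain ⟨l, -, hl⟩ := hK.ultrafilter_le_nhds ((hyperfilter ℕ).map a) (by
    rw [Ultrafilter.coe_map, le_principal_iff, Filter.mem_map]
    exact Filter.univ_mem' fun n => abs_le.1 (h n))
  exact ⟨l, hl⟩

lemma exists_d {p : Fin κ → ℝ} (hp : ∀ i, 0 ≤ p i) (hp1 : ∑ i, p i = 1) {T : Fin κ → Mat2}
    (hT : ∀ i, (T i).det = 1) :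
    ∃ d : ℝ × ℝ → ℝ, ∀ v, 0 < qf v → Tendsto (fun n : ℕ => (ell p T n - uu p T n v) / n)
      (hyperfilter ℕ : Filter ℕ) (𝓝 (d v)) := by
  have : ∀ v : ℝ × ℝ, ∃ l : ℝ, 0 < qf v → Tendsto (fun n : ℕ => (ell p T n - uu p T n v) / n)
      (hyperfilter ℕ : Filter ℕ) (𝓝 l) := by
    intro v
    by_cases hv : 0 < qf v
    · have hup : ∀ n : ℕ, ell p T n ≤ n * ell p T 1 + ell p T 0 := by
        intro n
        induction n with
        | zero => simp
        | succ n ih =>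
          have := ell_subadd hp hp1 hT n 1
          push_cast; linarith
      have h0 := ell_nonneg hp hp1 hT 0
      have h1 := ell_nonneg hp hp1 hT 1
      have hD1 : ∀ n : ℕ, -|Real.log (qf v)| ≤ ell p T n - uu p T n v := by
        intro n
        unfold ell uu
        rw [← Ex_sub, ← Ex_const hp1 T n (-|Real.log (qf v)|)]
        refine Ex_mono hp hp1 hT n _ _ fun M hM => ?_
        have h1 := Real.log_le_log (qf_act_pos hM hv) (qf_act_le M v)
        rw [Real.log_mul (by linarith [two_le_nsq hM]) hv.ne'] at h1
        linarith [le_abs_self (Real.log (qf v))]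
      have hD2 : ∀ n : ℕ, ell p T n - uu p T n v ≤ 2 * ell p T n + |Real.log (qf v)| := by
        intro n
        unfold ell uu
        rw [← Ex_sub, ← Ex_smul, ← Ex_const hp1 T n (|Real.log (qf v)|), ← Ex_addf]
        refine Ex_mono hp hp1 hT n _ _ fun M hM => ?_
        have h1 := Real.log_le_log hv (qf_le_act hM v)
        rw [Real.log_mul (by linarith [two_le_nsq hM]) (qf_act_pos hM hv).ne'] at h1
        linarith [neg_abs_le (Real.log (qf v))]
      obtain ⟨l, hl⟩ := ultra_lim (fun n : ℕ => (ell p T n - uu p T n v) / n)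
        (2 * ell p T 1 + 2 * ell p T 0 + |Real.log (qf v)|) (by
          intro n
          rcases Nat.eq_zero_or_pos n with rfl | hn
          · simp; positivity
          · have hn1 : (1 : ℝ) ≤ n := by exact_mod_cast hn
            have hn0 : (0 : ℝ) < n := by linarith
            rw [abs_div, Nat.abs_cast, div_le_iff₀ hn0, abs_le]
            have a1 := hD1 n
            have a2 := hD2 n
            have a3 := hup n
            have a4 := abs_nonneg (Real.log (qf v))
            constructor <;> nlinarith)
      exact ⟨l, fun _ => hl⟩
    · exact ⟨0, fun h => absurd h hv⟩
  choose d hd using this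
  exact ⟨d, hd⟩

lemma dichotomy {p : Fin κ → ℝ} (hp : ∀ i, 0 < p i) (hp1 : ∑ i, p i = 1) {T : Fin κ → Mat2}
    (hT : ∀ i, (T i).det = 1) {l : ℝ} (hl : HasLam p T l) (hl0 : 0 < l) :
    (∀ v, 0 < qf v → ∃ n, 1 ≤ n ∧ Real.log (qf v) < uu p T n v) ∨
    (∃ v, 0 < qf v ∧ ∃ c : Fin κ → ℝ, (∀ i, act (T i) v = c i • v) ∧
      ∑ i, p i * Real.log |c i| < 0) := by
  have hp0 : ∀ i, 0 ≤ p i := fun i => (hp i).le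
  by_contra hcon
  push Not at hcon
  obtain ⟨⟨v0, hv0, hu0⟩, hno⟩ := hcon
  obtain ⟨d, hd⟩ := exists_d hp0 hp1 hT
  have hle : (hyperfilter ℕ : Filter ℕ) ≤ atTop := Nat.hyperfilter_le_atTop
  have hlU : Tendsto (fun n : ℕ => ell p T n / n) (hyperfilter ℕ : Filter ℕ) (𝓝 l) := hl.mono_left hle
  have hCU : ∀ C : ℝ, Tendsto (fun n : ℕ => C / (n : ℝ)) (hyperfilter ℕ : Filter ℕ) (𝓝 0) :=
    fun C => (const_div_tendsto C).mono_left hle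
  -- norm bound
  obtain ⟨K, hK0, hK⟩ : ∃ K : ℝ, 0 < K ∧ ∀ i, nsq (T i) ≤ K := by
    refine ⟨1 + ∑ i, nsq (T i), ?_, fun i => ?_⟩
    · have := Finset.sum_nonneg (fun i (_ : i ∈ Finset.univ) => nsq_nonneg (T i)); linarith
    · have := Finset.single_le_sum (f := fun i => nsq (T i)) (fun j _ => nsq_nonneg _) (Finset.mem_univ i)
      linarith
  -- homogeneity
  have hhom : ∀ v, 0 < qf v → ∀ c : ℝ, c ≠ 0 → d (c • v) = d v := by
    intro v hv c hc
    have hcv : 0 < qf (c • v) := by rw [qf_smul]; positivity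
    refine tendsto_nhds_unique (hd _ hcv) ?_
    have h := (hd v hv).sub (hCU (Real.log (c ^ 2)))
    rw [sub_zero] at h
    refine h.congr fun n => ?_
    rw [uu_smul hp0 hp1 hT n hv hc, ← sub_div]; congr 1; ring
  -- harmonicity
  have hharm : ∀ v, 0 < qf v → d v = ∑ i, p i * d (act (T i) v) := by
    intro v hv
    have h1 : Tendsto (fun n : ℕ => ∑ i, p i * ((ell p T n - uu p T n (act (T i) v)) / n))
        (hyperfilter ℕ : Filter ℕ) (𝓝 (∑ i, p i * d (act (T i) v))) :=
      tendsto_finsetSum _ fun i _ => (hd _ (qf_act_pos (hT i) hv)).const_mul _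
    have h2 : Tendsto (fun n : ℕ => (uu p T (n + 1) v - uu p T n v) / n)
        (hyperfilter ℕ : Filter ℕ) (𝓝 0) := by
      refine squeeze_zero_norm (fun n => ?_) (hCU (Real.log K))
      rw [Real.norm_eq_abs, abs_div, Nat.abs_cast]
      exact div_le_div_of_nonneg_right (uu_step hp0 hp1 hT hK hK0 n hv) (Nat.cast_nonneg n)
    have h3 := h1.add h2
    rw [add_zero] at h3
    refine tendsto_nhds_unique (hd v hv) (h3.congr fun n => ?_)
    have e1 : ∑ i, p i * ((ell p T n - uu p T n (act (T i) v)) / n)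
        = (ell p T n - uu p T (n + 1) v) / n := by
      rw [uu_succ]
      simp_rw [mul_div_assoc', ← Finset.sum_div, mul_sub, Finset.sum_sub_distrib, ← Finset.sum_mul,
        hp1, one_mul]
    rw [e1, ← add_div]; congr 1; ring
  -- three lines
  have hthree : ∀ a b c, wd a b ≠ 0 → wd b c ≠ 0 → wd a c ≠ 0 → d a + d b + d c ≤ 2 * l := by
    intro a b c hab hbc hac
    obtain ⟨C, hC⟩ := three_bound hab hbc hac
    have h1 := ((hd a (qf_pos_of_wd hab).1).add (hd b (qf_pos_of_wd hab).2)).add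
      (hd c (qf_pos_of_wd hbc).2)
    have h2 := (hlU.const_mul 2).add (hCU C)
    rw [add_zero] at h2
    refine le_of_tendsto_of_tendsto' h1 h2 fun n => ?_
    have h3 := Ex_mono hp0 hp1 hT n _ _ hC
    rw [Ex_addf, Ex_addf, Ex_addf, Ex_sub, Ex_sub, Ex_sub, Ex_smul, Ex_const hp1] at h3
    have h4 : (ell p T n - uu p T n a) + (ell p T n - uu p T n b) + (ell p T n - uu p T n c) ≤
      2 * ell p T n + C := h3
    rw [← add_div, ← add_div, mul_div_assoc', ← add_div]
    exact div_le_div_of_nonneg_right h4 (Nat.cast_nonneg n)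
  have hd0 : l ≤ d v0 := by
    have h2 := hlU.sub (hCU (Real.log (qf v0)))
    rw [sub_zero] at h2
    refine le_of_tendsto_of_tendsto h2 (hd v0 hv0) ?_
    have : ∀ᶠ n : ℕ in (hyperfilter ℕ : Filter ℕ), 1 ≤ n := hle (eventually_ge_atTop 1)
    filter_upwards [this] with n hn
    rw [← sub_div]
    exact div_le_div_of_nonneg_right (by linarith [hu0 n hn]) (Nat.cast_nonneg n)
  -- distinct values give non-parallel vectors
  have hdist : ∀ a b, 0 < qf a → 0 < qf b → d a ≠ d b → wd a b ≠ 0 := by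
    intro a b ha hb hne h
    obtain ⟨c, rfl⟩ := par_of_wd ha h
    have hc : c ≠ 0 := by rintro rfl; simp [qf] at hb
    exact hne (hhom a ha c hc).symm
  -- maximal vector
  obtain ⟨v, hv, hdv, hmax⟩ : ∃ v, 0 < qf v ∧ l ≤ d v ∧ ∀ w, 0 < qf w → d w ≤ d v := by
    by_cases h : ∀ w, 0 < qf w → d w ≤ d v0
    · exact ⟨v0, hv0, hd0, h⟩
    · push Not at h
      obtain ⟨v1, hv1, h1⟩ := h
      refine ⟨v1, hv1, by linarith, fun w hw => ?_⟩
      by_contra hc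
      push Not at hc
      have := hthree v0 v1 w (hdist _ _ hv0 hv1 (by linarith)) (hdist _ _ hv1 hw (by linarith))
        (hdist _ _ hv0 hw (by linarith))
      linarith
  have heq : ∀ x, 0 < qf x → d x = d v → ∀ i, d (act (T i) x) = d v := by
    intro x hx hdx i
    by_contra hne
    have h1 := hharm x hx
    have hlt : d (act (T i) x) < d v := lt_of_le_of_ne (hmax _ (qf_act_pos (hT i) hx)) hne
    have h2 : ∑ j, p j * d (act (T j) x) < ∑ j, p j * d v := by
      refine Finset.sum_lt_sum (fun j _ => mul_le_mul_of_nonneg_left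
        (hmax _ (qf_act_pos (hT j) hx)) (hp0 j)) ⟨i, Finset.mem_univ _, ?_⟩
      exact mul_lt_mul_of_pos_left hlt (hp i)
    rw [← Finset.sum_mul, hp1, one_mul] at h2
    linarith
  by_cases hcase : ∀ i, wd v (act (T i) v) = 0
  · -- Case 1
    choose c hc using fun i => par_of_wd hv (hcase i)
    have hc0 : ∀ i, c i ≠ 0 := by
      intro i h
      have := qf_act_pos (hT i) hv
      rw [hc i, h] at this; simp [qf] at this
    have hlam0 := hno v hv c hc
    have huu : ∀ n : ℕ, uu p T n v = Real.log (qf v) + n * (2 * ∑ i, p i * Real.log |c i|) := by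
      intro n
      induction n with
      | zero => simp [uu, Ex, act_one]
      | succ n ih =>
        rw [uu_succ]
        simp_rw [hc, fun i => uu_smul hp0 hp1 hT n hv (hc0 i), ih, mul_add, Finset.sum_add_distrib,
          ← Finset.sum_mul, hp1, Real.log_pow, Real.log_abs]
        push_cast
        have : ∑ x, p x * (2 * Real.log (c x)) = 2 * ∑ x, p x * Real.log (c x) := by
          rw [Finset.mul_sum]; exact Finset.sum_congr rfl fun i _ => by ring
        rw [this]; ring
    have hdval : d v = l - 2 * ∑ i, p i * Real.log |c i| := by
      refine tendsto_nhds_unique (hd v hv) ?_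
      have h2 := (hlU.sub (hCU (Real.log (qf v)))).sub_const (2 * ∑ i, p i * Real.log |c i|)
      rw [sub_zero] at h2
      refine h2.congr' ?_
      have : ∀ᶠ n : ℕ in (hyperfilter ℕ : Filter ℕ), 1 ≤ n := hle (eventually_ge_atTop 1)
      filter_upwards [this] with n hn
      have hn0 : (n : ℝ) ≠ 0 := by positivity
      rw [huu]; field_simp; ring
    have hlam : ∑ i, p i * Real.log |c i| = 0 := by linarith
    set w : ℝ × ℝ := (v.2, -v.1) with hw
    have hwv : wd w v = qf v := by simp [wd, qf, hw]; ring
    have hwv0 : wd w v ≠ 0 := by rw [hwv]; exact hv.ne'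
    have hQP := Qm_Pm hwv0
    have hl' := hl.conj hp0 hp1 hT hQP
    have hdet : ∀ i, (Qm w v * T i * Pm w v).det = 1 := fun i => cj_det hQP (hT i)
    have h01 : ∀ i, (Qm w v * T i * Pm w v) 0 1 = 0 := by
      intro i
      rw [(cj_entries hwv0 (T i)).2.1, hc i]
      simp [wd]; left; ring
    have h11 : ∀ i, (Qm w v * T i * Pm w v) 1 1 = c i := by
      intro i
      rw [(cj_entries hwv0 (T i)).2.2.2, hc i, div_eq_iff hwv0]
      simp [wd]; ring
    have h00 : ∀ i, (Qm w v * T i * Pm w v) 0 0 = (c i)⁻¹ := by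
      intro i
      have := hdet i
      rw [Matrix.det_fin_two, h01, h11] at this
      have := hc0 i
      field_simp
      linarith
    have := tri_case hp0 hp1 hdet h01 (by
      simp_rw [h00, abs_inv, Real.log_inv, mul_neg, Finset.sum_neg_distrib, hlam, neg_zero]) hl'
    linarith
  · -- Case 2
    push Not at hcase
    obtain ⟨i0, hi0⟩ := hcase
    set w := act (T i0) v with hw
    have hwq : 0 < qf w := qf_act_pos (hT i0) hv
    have hdw : d w = d v := heq v hv rfl i0
    have hpar : ∀ x, 0 < qf x → d x = d v → wd v x = 0 ∨ wd w x = 0 := by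
      intro x hx hdx
      by_contra hc
      push Not at hc
      have := hthree v w x hi0 hc.2 hc.1
      linarith
    have hQP := Qm_Pm hi0
    have hl' := hl.conj hp0 hp1 hT hQP
    have hdet : ∀ i, (Qm v w * T i * Pm v w).det = 1 := fun i => cj_det hQP (hT i)
    have anti : ∀ a b, wd a b = - wd b a := by intro a b; simp [wd]; ring
    -- two parallel to the same line is impossible
    have himp : ∀ i x, 0 < qf x → wd x (act (T i) v) = 0 → wd x (act (T i) w) = 0 → False := by
      intro i x hx h1 h2
      obtain ⟨a, ha⟩ := par_of_wd hx h1
      obtain ⟨b, hb⟩ := par_of_wd hx h2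
      have := wd_act (T i) v w
      rw [hT, one_mul, ha, hb] at this
      apply hi0
      rw [← this]; simp [wd]; ring
    have hmono : ∀ i, Mono (Qm v w * T i * Pm v w) := by
      intro i
      obtain ⟨e1, e2, e3, e4⟩ := cj_entries hi0 (T i)
      have hdt := hdet i
      rw [Matrix.det_fin_two] at hdt
      rcases hpar _ (qf_act_pos (hT i) hv) (heq v hv rfl i) with h1 | h1 <;>
        rcases hpar _ (qf_act_pos (hT i) hwq) (heq w hwq hdw i) with h2 | h2
      · exact (himp i v hv h1 h2).elim
      · left
        have z1 : (Qm v w * T i * Pm v w) 0 1 = 0 := by rw [e2, anti, h2]; simp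
        have z2 : (Qm v w * T i * Pm v w) 1 0 = 0 := by rw [e3, h1]; simp
        rw [z1, z2] at hdt
        exact ⟨z1, z2, by linarith⟩
      · right
        have z1 : (Qm v w * T i * Pm v w) 0 0 = 0 := by rw [e1, anti, h1]; simp
        have z2 : (Qm v w * T i * Pm v w) 1 1 = 0 := by rw [e4, h2]; simp
        rw [z1, z2] at hdt
        exact ⟨z1, z2, by linarith⟩
      · exact (himp i w hwq h1 h2).elim
    have hsw : (Qm v w * T i0 * Pm v w) 0 1 ≠ 0 := by
      have e3 := (cj_entries hi0 (T i0)).2.2.1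
      rw [← hw, div_self hi0] at e3
      rcases hmono i0 with ⟨a, b, c⟩ | ⟨a, b, c⟩
      · rw [e3] at b; norm_num at b
      · intro h; rw [h] at c; norm_num at c
    have := swap_case hp hp1 hmono hl' i0 hsw
    linarith

end part7

section part8
open MeasureTheory Filter Topology
variable {κ : ℕ}

/-! ### Entrywise neighbourhoods -/

def near (η : ℝ) (T B : Fin κ → Mat2) : Prop := ∀ i a b, |B i a b - T i a b| < η

lemma near_of_nhdsSet {S W : Set (Fin κ → Mat2)} (hS : IsCompact S) (hW : W ∈ 𝓝ˢ S) :
    ∃ η : ℝ, 0 < η ∧ ∀ T ∈ S, ∀ B, near η T B → B ∈ W := by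
  obtain ⟨O, hO, hSO, hOW⟩ := mem_nhdsSet_iff_exists.1 hW
  obtain ⟨δ, hδ, h⟩ := IsCompact.exists_thickening_subset_open (α := Fin κ → Fin 2 → Fin 2 → ℝ)
    (s := S) (t := O) hS hO hSO
  refine ⟨δ, hδ, fun T hT B hB => hOW (h ?_)⟩
  have key : ∀ B' T' : Fin κ → Fin 2 → Fin 2 → ℝ, (∀ i a b, |B' i a b - T' i a b| < δ) →
      dist B' T' < δ := by
    intro B' T' h'
    refine (dist_pi_lt_iff hδ).2 fun i => (dist_pi_lt_iff hδ).2 fun a => (dist_pi_lt_iff hδ).2 fun b => ?_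
    rw [Real.dist_eq]; exact h' i a b
  exact (Metric.mem_thickening_iff (X := Fin κ → Fin 2 → Fin 2 → ℝ)).2 ⟨T, hT, key B T hB⟩

def GoodAt (p : Fin κ → ℝ) (η t C r : ℝ) (A : Fin κ → Mat2) : Prop :=
  ∀ B : Fin κ → Mat2, (∀ i, (B i).det = 1) → near η A B → ∀ n,
    Ex p B n (fun M => nsq M ^ (-t)) ≤ C * r ^ n

lemma qf_e1 : qf ((1, 0) : ℝ × ℝ) = 1 := by simp [qf]

lemma qf_act_e1_le (M : Mat2) : qf (act M (1, 0)) ≤ nsq M := by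
  have := qf_act_le M (1, 0); rwa [qf_e1, mul_one] at this

/-- Moment bound in a neighbourhood of a tuple expanding on average. -/
lemma good_of_expanding {p : Fin κ → ℝ} (hp : ∀ i, 0 ≤ p i) (hp1 : ∑ i, p i = 1)
    (A : Fin κ → Mat2) (hA : ∀ i, (A i).det = 1)
    (hexp : ∀ v, 0 < qf v → ∃ n, 1 ≤ n ∧ Real.log (qf v) < uu p A n v) :
    ∃ η t C r : ℝ, 0 < η ∧ t ≤ 1 ∧ 0 ≤ C ∧ 0 < r ∧ r < 1 ∧ GoodAt p η t C r A := by
  obtain ⟨N, γ, K, W, hW, hγ, hK, hU⟩ := UEx_open hp hp1 {A} isCompact_singleton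
    (by rintro T rfl; exact hA) (by rintro T rfl; exact hexp)
  obtain ⟨η, hη, hnear⟩ := near_of_nhdsSet isCompact_singleton hW
  obtain ⟨t, C, r, ht, ht1, hC, hr, hr1, hmom⟩ := moment_of_UEx hp hp1 (N := N) hγ hK
  refine ⟨η, t, C, r, hη, ht1, hC, hr, hr1, fun B hB hBn n => ?_⟩
  have h1 := hmom B (hU B (hnear A rfl B hBn) hB) n (1, 0) (by rw [qf_e1]; exact one_pos)
  rw [qf_e1, Real.one_rpow, mul_one] at h1
  refine le_trans (Ex_mono hp hp1 hB n _ _ fun M hM => ?_) h1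
  exact Real.rpow_le_rpow_of_nonpos (qf_act_pos hM (by rw [qf_e1]; exact one_pos))
    (qf_act_e1_le M) (by linarith)

/-! ### Upper triangular limits -/

lemma upper_lam {p : Fin κ → ℝ} (hp : ∀ i, 0 ≤ p i) (hp1 : ∑ i, p i = 1) {T : Fin κ → Mat2}
    (hT : ∀ i, (T i).det = 1) (h10 : ∀ i, T i 1 0 = 0) {l : ℝ} (hl : HasLam p T l) :
    2 * ∑ i, p i * Real.log |T i 0 0| ≤ l := by
  set s := 2 * ∑ i, p i * Real.log |T i 0 0| with hs
  have hne : ∀ M : Mat2, M.det = 1 → M 1 0 = 0 → M 0 0 ≠ 0 := by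
    intro M hM h h0
    rw [Matrix.det_fin_two, h, h0] at hM; norm_num at hM
  have hP : ∀ (n : ℕ) (M : Mat2) (i : Fin κ), (M.det = 1 ∧ M 1 0 = 0) →
      ((M * T i).det = 1 ∧ (M * T i) 1 0 = 0) := by
    rintro n M i ⟨h1, h2⟩
    refine ⟨by rw [Matrix.det_mul, h1, hT, one_mul], ?_⟩
    rw [mul10, h2, h10]; ring
  have hE : ∀ n : ℕ, n * s ≤ Ex p T n (fun M => Real.log (M 0 0 ^ 2)) := by
    intro n
    induction n with
    | zero => simp [Ex]
    | succ n ih =>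
      rw [Ex_succ]
      have h1 : ∀ i, 2 * Real.log |T i 0 0| + n * s ≤ Ex p T n (fun M => Real.log ((M * T i) 0 0 ^ 2)) := by
        intro i
        calc _ ≤ 2 * Real.log |T i 0 0| + Ex p T n (fun M => Real.log (M 0 0 ^ 2)) := by linarith
          _ = Ex p T n (fun M => 2 * Real.log |T i 0 0| + Real.log (M 0 0 ^ 2)) := by
              rw [Ex_addf, Ex_const hp1]
          _ ≤ _ := by
              refine Ex_mono_P hp hp1 T (fun _ M => M.det = 1 ∧ M 1 0 = 0) (by simp) hP n _ _
                fun M hM => le_of_eq ?_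
              have a1 := hne M hM.1 hM.2
              have a2 := hne (T i) (hT i) (h10 i)
              rw [mul00, h10, mul_zero, add_zero, mul_pow, Real.log_mul (by positivity) (by positivity),
                Real.log_pow, Real.log_pow, Real.log_abs]
              push_cast; ring
      calc ((n + 1 : ℕ) : ℝ) * s = ∑ i, p i * (2 * Real.log |T i 0 0| + n * s) := by
            simp_rw [mul_add, Finset.sum_add_distrib, ← Finset.sum_mul, hp1]
            have : ∑ i, p i * (2 * Real.log |T i 0 0|) = s := by
              rw [hs, Finset.mul_sum]; exact Finset.sum_congr rfl fun i _ => by ring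
            rw [this]; push_cast; ring
        _ ≤ _ := Finset.sum_le_sum fun i _ => mul_le_mul_of_nonneg_left (h1 i) (hp i)
  refine ge_of_tendsto hl ?_
  filter_upwards [eventually_ge_atTop 1] with n hn
  have hn0 : (0 : ℝ) < n := by positivity
  rw [le_div_iff₀ hn0, mul_comm]
  refine (hE n).trans ?_
  unfold ell
  refine Ex_mono_P hp hp1 T (fun _ M => M.det = 1 ∧ M 1 0 = 0) (by simp) hP n _ _ fun M hM => ?_
  have a1 := hne M hM.1 hM.2
  refine Real.log_le_log (by positivity) ?_
  unfold nsq; nlinarith [sq_nonneg (M 0 1), sq_nonneg (M 1 0), sq_nonneg (M 1 1)]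

def Tb (A : Fin κ → Mat2) (β : Fin κ → ℝ) : Fin κ → Mat2 := fun i => !![A i 0 0, β i; 0, A i 1 1]

def Sβ (i0 : Fin κ) : Set (Fin κ → ℝ) :=
  {β | (∀ i, |β i| ≤ 1) ∧ β i0 = 0 ∧ ∃ i, |β i| = 1}

lemma Sβ_compact (i0 : Fin κ) : IsCompact (Sβ i0) := by
  have h1 : IsCompact (Set.Icc (fun _ : Fin κ => (-1 : ℝ)) (fun _ => 1)) := isCompact_Icc
  refine h1.of_isClosed_subset ?_ ?_
  · have : Sβ i0 = (⋂ i, {β : Fin κ → ℝ | |β i| ≤ 1}) ∩ ({β | β i0 = 0} ∩ ⋃ i, {β : Fin κ → ℝ | |β i| = 1}) := by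
      ext β; simp [Sβ]
    rw [this]
    refine (isClosed_iInter fun i => isClosed_le (by fun_prop) continuous_const).inter
      ((isClosed_eq (by fun_prop) continuous_const).inter
      (isClosed_iUnion_of_finite fun i => isClosed_eq (by fun_prop) continuous_const))
  · rintro β ⟨h, -, -⟩
    exact ⟨fun i => (abs_le.1 (h i)).1, fun i => (abs_le.1 (h i)).2⟩

lemma Tb_continuous (A : Fin κ → Mat2) : Continuous (Tb A) := by
  refine continuous_pi fun i => continuous_matrix fun a b => ?_
  fin_cases a <;> fin_cases b <;> simp [Tb] <;> fun_prop

lemma Tb_expand {p : Fin κ → ℝ} (hp : ∀ i, 0 < p i) (hp1 : ∑ i, p i = 1)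
    {A : Fin κ → Mat2} (hA : ∀ i, A i 0 0 * A i 1 1 = 1) (hpos : 0 < ∑ i, p i * Real.log |A i 0 0|)
    {i0 : Fin κ} (hi0 : A i0 0 0 ≠ A i0 1 1) {β : Fin κ → ℝ} (hβ : β ∈ Sβ i0) :
    ∀ v, 0 < qf v → ∃ n, 1 ≤ n ∧ Real.log (qf v) < uu p (Tb A β) n v := by
  have hp0 : ∀ i, 0 ≤ p i := fun i => (hp i).le
  have hdet : ∀ i, (Tb A β i).det = 1 := by
    intro i; rw [Matrix.det_fin_two]; simp [Tb, hA]
  obtain ⟨l, hl⟩ := exists_HasLam hp0 hp1 hdet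
  have hl0 := upper_lam hp0 hp1 hdet (fun i => by simp [Tb]) hl
  have e00 : ∀ i, Tb A β i 0 0 = A i 0 0 := fun i => by simp [Tb]
  simp_rw [e00] at hl0
  rcases dichotomy hp hp1 hdet hl (by linarith) with h | ⟨v, hv, c, hc, hneg⟩
  · exact h
  · exfalso
    obtain ⟨h1, h2, i1, h3⟩ := hβ
    have hx : ∀ i, A i 0 0 * v.1 + β i * v.2 = c i * v.1 := by
      intro i; have := congrArg Prod.fst (hc i); simpa [act, Tb] using this
    have hy : ∀ i, A i 1 1 * v.2 = c i * v.2 := by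
      intro i; have := congrArg Prod.snd (hc i); simpa [act, Tb] using this
    by_cases hv2 : v.2 = 0
    · have hv1 : v.1 ≠ 0 := by intro h; simp [qf, h, hv2] at hv
      have : ∀ i, c i = A i 0 0 := by
        intro i; have := hx i; rw [hv2, mul_zero, add_zero] at this
        exact (mul_right_cancel₀ hv1 this).symm
      simp_rw [this] at hneg
      linarith
    · have hcd : ∀ i, c i = A i 1 1 := fun i => (mul_right_cancel₀ hv2 (hy i)).symm
      have hv1 : v.1 = 0 := by
        have := hx i0
        rw [h2, hcd] at this
        by_contra hne
        exact hi0 (mul_right_cancel₀ hne (by linarith))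
      have := hx i1
      rw [hv1] at this
      have hb : β i1 = 0 := by
        have h5 : β i1 * v.2 = 0 := by linarith
        rcases mul_eq_zero.1 h5 with h | h
        · exact h
        · exact absurd h hv2
      rw [hb] at h3; norm_num at h3

/-! ### The exactly lower triangular case -/

lemma lower_scalar {p : Fin κ → ℝ} (hp : ∀ i, 0 ≤ p i) (hp1 : ∑ i, p i = 1) (a : Fin κ → ℝ)
    (ha : ∀ i, a i ≠ 0) (hpos : 0 < ∑ i, p i * Real.log |a i|) :
    ∃ t r η : ℝ, 0 < t ∧ t ≤ 1 ∧ 0 < r ∧ r < 1 ∧ 0 < η ∧ ∀ b : Fin κ → ℝ, (∀ i, |b i - a i| < η) →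
      ∑ i, p i * (b i ^ 2) ^ (-t) ≤ r := by
  set R := 1 + ∑ i, |Real.log (a i ^ 2)| with hR
  have hR0 : 0 ≤ ∑ i, |Real.log (a i ^ 2)| := Finset.sum_nonneg fun i _ => abs_nonneg _
  set γ := 2 * ∑ i, p i * Real.log |a i| with hγ
  obtain ⟨t, ht, ht1, htR, htγ, htq⟩ := pick_t R γ (by linarith) (by linarith)
  have htγ0 : 0 < t * γ := by positivity
  have h1 : ∑ i, p i * (a i ^ 2) ^ (-t) ≤ 1 - t * γ / 2 := by
    calc _ ≤ ∑ i, p i * (1 - t * Real.log (a i ^ 2) + t ^ 2 * R ^ 2) := by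
          refine Finset.sum_le_sum fun i _ => mul_le_mul_of_nonneg_left ?_ (hp i)
          have := ha i
          refine rpow_neg_le_quad (by positivity) ?_ ht.le htR
          have := Finset.single_le_sum (f := fun i => |Real.log (a i ^ 2)|)
            (fun j _ => abs_nonneg _) (Finset.mem_univ i)
          linarith
      _ = 1 - t * γ + t ^ 2 * R ^ 2 := by
          have e : ∀ i, p i * (1 - t * Real.log (a i ^ 2) + t ^ 2 * R ^ 2) =
              p i * (1 + t ^ 2 * R ^ 2) - (2 * t) * (p i * Real.log |a i|) := by
            intro i; rw [Real.log_pow, Real.log_abs]; push_cast; ring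
          simp_rw [e, Finset.sum_sub_distrib, ← Finset.sum_mul, hp1, ← Finset.mul_sum]
          rw [hγ]; ring
      _ ≤ _ := by linarith
  have hcont : ContinuousAt (fun b : Fin κ → ℝ => ∑ i, p i * (b i ^ 2) ^ (-t)) a := by
    refine tendsto_finsetSum _ fun i _ => Filter.Tendsto.const_mul _ ?_
    have h2 : ContinuousAt (fun b : Fin κ → ℝ => b i ^ 2) a :=
      ((continuous_apply i).pow 2).continuousAt
    have := ha i
    exact h2.rpow_const (Or.inl (by positivity))
  have hev := hcont.eventually (gt_mem_nhds (show ∑ i, p i * (a i ^ 2) ^ (-t) < 1 - t * γ / 4 by linarith))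
  obtain ⟨η, hη, h⟩ := Metric.eventually_nhds_iff.1 hev
  refine ⟨t, 1 - t * γ / 4, η, ht, ht1, by linarith, by linarith, hη, fun b hb => (h ?_).le⟩
  exact (dist_pi_lt_iff hη).2 fun i => by rw [Real.dist_eq]; exact hb i

lemma lower_moment {p : Fin κ → ℝ} (hp : ∀ i, 0 ≤ p i) (hp1 : ∑ i, p i = 1) {T : Fin κ → Mat2}
    (hT : ∀ i, (T i).det = 1) (h01 : ∀ i, T i 0 1 = 0) {t r : ℝ} (ht : 0 ≤ t)
    (hr : ∑ i, p i * (T i 0 0 ^ 2) ^ (-t) ≤ r) (hr0 : 0 ≤ r) (n : ℕ) :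
    Ex p T n (fun M => qf (act M (1, 0)) ^ (-t)) ≤ r ^ n := by
  have hP : ∀ (n : ℕ) (M : Mat2) (i : Fin κ), (M.det = 1 ∧ M 0 1 = 0) →
      ((M * T i).det = 1 ∧ (M * T i) 0 1 = 0) := by
    rintro n M i ⟨h1, h2⟩
    refine ⟨by rw [Matrix.det_mul, h1, hT, one_mul], ?_⟩
    rw [mul01, h2, h01]; ring
  have h1 : Ex p T n (fun M => (M 0 0 ^ 2) ^ (-t)) ≤ r ^ n := by
    induction n with
    | zero => simp [Ex]
    | succ n ih =>
      rw [Ex_succ]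
      calc _ ≤ ∑ i, p i * ((T i 0 0 ^ 2) ^ (-t) * r ^ n) := by
            refine Finset.sum_le_sum fun i _ => mul_le_mul_of_nonneg_left ?_ (hp i)
            calc _ ≤ Ex p T n (fun M => (T i 0 0 ^ 2) ^ (-t) * (M 0 0 ^ 2) ^ (-t)) := by
                  refine Ex_mono_P hp hp1 T (fun _ M => M.det = 1 ∧ M 0 1 = 0) (by simp) hP n _ _
                    fun M hM => le_of_eq ?_
                  rw [mul00, hM.2, zero_mul, add_zero, mul_pow, mul_comm,
                    Real.mul_rpow (sq_nonneg _) (sq_nonneg _)]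
              _ = (T i 0 0 ^ 2) ^ (-t) * Ex p T n (fun M => (M 0 0 ^ 2) ^ (-t)) := Ex_smul _ _ _ _ _
              _ ≤ _ := mul_le_mul_of_nonneg_left ih (Real.rpow_nonneg (sq_nonneg _) _)
        _ = (∑ i, p i * (T i 0 0 ^ 2) ^ (-t)) * r ^ n := by
            rw [Finset.sum_mul]; exact Finset.sum_congr rfl fun i _ => by ring
        _ ≤ r * r ^ n := mul_le_mul_of_nonneg_right hr (by positivity)
        _ = _ := by ring
  refine le_trans (Ex_mono_P hp hp1 T (fun _ M => M.det = 1 ∧ M 0 1 = 0) (by simp) hP n _ _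
    fun M hM => ?_) h1
  have h00 : M 0 0 ≠ 0 := by
    intro h; have := hM.1; rw [Matrix.det_fin_two, h, hM.2] at this; norm_num at this
  refine Real.rpow_le_rpow_of_nonpos (by positivity) ?_ (by linarith)
  simp [qf, act]; positivity

/-! ### Shear and scaling -/

def Gm (τ ε : ℝ) : Mat2 := !![1, τ; 0, ε]
def Gi (τ ε : ℝ) : Mat2 := !![1, -τ / ε; 0, ε⁻¹]

lemma Gm_Gi {τ ε : ℝ} (hε : ε ≠ 0) : Gm τ ε * Gi τ ε = 1 := by
  ext i j
  fin_cases i <;> fin_cases j <;> simp [Gm, Gi, hε]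
  field_simp; ring

lemma G_entries {τ ε : ℝ} (hε : ε ≠ 0) (B : Mat2) :
    (Gm τ ε * B * Gi τ ε) 0 0 = B 0 0 + τ * B 1 0 ∧
    (Gm τ ε * B * Gi τ ε) 0 1 = (B 0 1 + τ * (B 1 1 - B 0 0) - B 1 0 * τ ^ 2) / ε ∧
    (Gm τ ε * B * Gi τ ε) 1 0 = ε * B 1 0 ∧
    (Gm τ ε * B * Gi τ ε) 1 1 = B 1 1 - τ * B 1 0 := by
  simp only [mul00, mul01, mul10, mul11]
  refine ⟨?_, ?_, ?_, ?_⟩ <;> simp [Gm, Gi] <;> field_simp <;> ring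

lemma G_moment {p : Fin κ → ℝ} (hp : ∀ i, 0 ≤ p i) (hp1 : ∑ i, p i = 1) {B : Fin κ → Mat2}
    (hB : ∀ i, (B i).det = 1) {τ ε : ℝ} (hτ : |τ| ≤ 1) (hε : 0 < ε) (hε1 : ε ≤ 1) {t : ℝ}
    (ht : 0 ≤ t) (ht1 : t ≤ 1) (n : ℕ) :
    Ex p B n (fun M => nsq M ^ (-t)) ≤
      3 * Ex p (fun i => Gm τ ε * B i * Gi τ ε) n (fun M => qf (act M (1, 0)) ^ (-t)) := by
  have hG := Gm_Gi (τ := τ) hε.ne'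
  rw [Ex_conj p B _ _ hG, ← Ex_smul]
  refine Ex_mono hp hp1 hB n _ _ fun M hM => ?_
  have hGe : act (Gi τ ε) (1, 0) = (1, 0) := by simp [act, Gi]
  have hn : nsq (Gm τ ε) ≤ 3 := by
    have h1 : τ ^ 2 ≤ 1 := (sq_le_one_iff_abs_le_one τ).2 hτ
    have h2 : ε ^ 2 ≤ 1 := by nlinarith
    simp [nsq, Gm]; linarith
  set X := qf (act (Gm τ ε * M * Gi τ ε) (1, 0)) with hX
  have hdet : (Gm τ ε * M * Gi τ ε).det = 1 := cj_det hG hM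
  have hXpos : 0 < X := qf_act_pos hdet (by rw [qf_e1]; exact one_pos)
  have h1 : X ≤ 3 * nsq M := by
    rw [hX, act_mul, act_mul, hGe]
    calc _ ≤ nsq (Gm τ ε) * qf (act M (1, 0)) := qf_act_le _ _
      _ ≤ 3 * nsq M := mul_le_mul hn (qf_act_e1_le M) (qf_nonneg _) (by norm_num)
  calc nsq M ^ (-t) ≤ (X / 3) ^ (-t) :=
        Real.rpow_le_rpow_of_nonpos (by positivity) (by linarith) (by linarith)
    _ = 3 ^ t * X ^ (-t) := by
        rw [Real.div_rpow hXpos.le (by norm_num), Real.rpow_neg (by norm_num : (0:ℝ) ≤ 3), div_inv_eq_mul,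
          mul_comm]
    _ ≤ 3 ^ (1 : ℝ) * X ^ (-t) := by
        refine mul_le_mul_of_nonneg_right ?_ (Real.rpow_nonneg hXpos.le _)
        exact Real.rpow_le_rpow_of_exponent_le (by norm_num) ht1
    _ = _ := by rw [Real.rpow_one]

end part8

section part9
open MeasureTheory Filter Topology
variable {κ : ℕ}

lemma root_exists {x y z τ0 η δ : ℝ} (hτ : 0 < τ0) (hx : |x| < η) (hy : 3 * δ / 4 ≤ |y|)
    (hδ : 0 < δ) (hz : |z| * τ0 ≤ δ / 8) (hη : η ≤ τ0 * δ / 8) :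
    ∃ τ, |τ| ≤ τ0 ∧ x + τ * y - z * τ ^ 2 = 0 := by
  have hc : ContinuousOn (fun τ : ℝ => x + τ * y - z * τ ^ 2) (Set.Icc (-τ0) τ0) := by fun_prop
  obtain ⟨hx1, hx2⟩ := abs_lt.1 hx
  have hz' : |z * τ0 ^ 2| ≤ τ0 * δ / 8 := by
    rw [abs_mul, abs_of_nonneg (sq_nonneg τ0)]; nlinarith
  obtain ⟨hz1, hz2⟩ := abs_le.1 hz'
  rcases le_total 0 y with h | h
  · rw [abs_of_nonneg h] at hy
    have hm : 3 * δ / 4 * τ0 ≤ y * τ0 := mul_le_mul_of_nonneg_right hy hτ.le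
    have : (0 : ℝ) ∈ Set.Icc ((fun τ : ℝ => x + τ * y - z * τ ^ 2) (-τ0))
        ((fun τ : ℝ => x + τ * y - z * τ ^ 2) τ0) := by
      constructor <;> simp only <;> nlinarith
    obtain ⟨τ, hτm, he⟩ := intermediate_value_Icc (by linarith) hc this
    exact ⟨τ, abs_le.2 hτm, he⟩
  · rw [abs_of_nonpos h] at hy
    have hm : 3 * δ / 4 * τ0 ≤ -y * τ0 := mul_le_mul_of_nonneg_right hy hτ.le
    have : (0 : ℝ) ∈ Set.Icc ((fun τ : ℝ => x + τ * y - z * τ ^ 2) τ0)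
        ((fun τ : ℝ => x + τ * y - z * τ ^ 2) (-τ0)) := by
      constructor <;> simp only <;> nlinarith
    obtain ⟨τ, hτm, he⟩ := intermediate_value_Icc' (by linarith) hc this
    exact ⟨τ, abs_le.2 hτm, he⟩

lemma shear {A : Fin κ → Mat2} (h01 : ∀ i, A i 0 1 = 0) {K : ℝ} (hK0 : 0 ≤ K)
    (hK : ∀ i a b, |A i a b| ≤ K) {i0 : Fin κ} (hi0 : A i0 0 0 ≠ A i0 1 1) {θ : ℝ} (hθ : 0 < θ) :
    ∃ η : ℝ, 0 < η ∧ ∀ B, near η A B → ∃ τ : ℝ, |τ| ≤ 1 ∧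
      B i0 0 1 + τ * (B i0 1 1 - B i0 0 0) - B i0 1 0 * τ ^ 2 = 0 ∧
      ∀ i, |B i 0 0 + τ * B i 1 0 - A i 0 0| < θ ∧
        |B i 0 1 + τ * (B i 1 1 - B i 0 0) - B i 1 0 * τ ^ 2| < θ ∧
        |B i 1 1 - τ * B i 1 0 - A i 1 1| < θ ∧ |B i 1 0| ≤ K + 1 := by
  set δ := |A i0 1 1 - A i0 0 0| with hδ
  have hδ0 : 0 < δ := abs_pos.2 (sub_ne_zero.2 hi0.symm)
  set K1 := K + 1 with hK1
  have hK1p : 0 < K1 := by linarith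
  set τ0 := min 1 (min (θ / (8 * K1)) (δ / (8 * K1))) with hτ0
  have hτp : 0 < τ0 := by positivity
  have t1 : τ0 ≤ 1 := min_le_left _ _
  have t2 : τ0 * (8 * K1) ≤ θ := by
    rw [← le_div_iff₀ (by positivity)]; exact (min_le_right _ _).trans (min_le_left _ _)
  have t3 : τ0 * (8 * K1) ≤ δ := by
    rw [← le_div_iff₀ (by positivity)]; exact (min_le_right _ _).trans (min_le_right _ _)
  set η := min (min 1 (θ / 4)) (min (τ0 * δ / 8) (δ / 8)) with hη
  have hηp : 0 < η := by positivity
  have e1 : η ≤ 1 := (min_le_left _ _).trans (min_le_left _ _)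
  have e2 : η ≤ θ / 4 := (min_le_left _ _).trans (min_le_right _ _)
  have e3 : η ≤ τ0 * δ / 8 := (min_le_right _ _).trans (min_le_left _ _)
  have e4 : η ≤ δ / 8 := (min_le_right _ _).trans (min_le_right _ _)
  refine ⟨η, hηp, fun B hB => ?_⟩
  have hBK : ∀ i a b, |B i a b| ≤ K1 := by
    intro i a b
    have h1 := hB i a b
    have h2 := hK i a b
    have h3 := abs_sub_abs_le_abs_sub (B i a b) (A i a b)
    linarith
  have hB01 : ∀ i, |B i 0 1| < η := by
    intro i; have := hB i 0 1; rwa [h01, sub_zero] at this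
  obtain ⟨τ, hτ, hroot⟩ := root_exists (x := B i0 0 1) (y := B i0 1 1 - B i0 0 0) (z := B i0 1 0)
    hτp (hB01 i0) (δ := δ) (by
      have h1 := abs_lt.1 (hB i0 0 0)
      have h2 := abs_lt.1 (hB i0 1 1)
      have h3 : δ - |B i0 1 1 - B i0 0 0| ≤ |(A i0 1 1 - A i0 0 0) - (B i0 1 1 - B i0 0 0)| :=
        abs_sub_abs_le_abs_sub _ _
      have h4 : |(A i0 1 1 - A i0 0 0) - (B i0 1 1 - B i0 0 0)| ≤ 2 * η := by
        rw [abs_le]; constructor <;> linarith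
      linarith) hδ0 (by nlinarith [hBK i0 1 0]) e3
  refine ⟨τ, hτ.trans t1, hroot, fun i => ?_⟩
  have m1 : |τ * B i 1 0| ≤ τ0 * K1 := by
    rw [abs_mul]; exact mul_le_mul hτ (hBK i 1 0) (abs_nonneg _) hτp.le
  have m2 : |τ * (B i 1 1 - B i 0 0)| ≤ τ0 * (2 * K1) := by
    rw [abs_mul]
    refine mul_le_mul hτ ?_ (abs_nonneg _) hτp.le
    have a1 := abs_le.1 (hBK i 1 1)
    have a2 := abs_le.1 (hBK i 0 0)
    rw [abs_le]; constructor <;> linarith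
  have m3 : |B i 1 0 * τ ^ 2| ≤ τ0 * K1 := by
    have : B i 1 0 * τ ^ 2 = (τ * B i 1 0) * τ := by ring
    rw [this, abs_mul]
    calc _ ≤ (τ0 * K1) * 1 := mul_le_mul m1 (hτ.trans t1) (abs_nonneg _) (by positivity)
      _ = _ := mul_one _
  have a1 := abs_lt.1 (hB i 0 0)
  have a2 := abs_lt.1 (hB i 1 1)
  have a3 := abs_lt.1 (hB01 i)
  rw [abs_le] at m1 m2 m3
  refine ⟨?_, ?_, ?_, hBK i 1 0⟩ <;> rw [abs_lt] <;> constructor <;> linarith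

lemma tri_moment {p : Fin κ → ℝ} (hp : ∀ i, 0 < p i) (hp1 : ∑ i, p i = 1) {A : Fin κ → Mat2}
    (hA : ∀ i, (A i).det = 1) (h01 : ∀ i, A i 0 1 = 0)
    (hpos : 0 < ∑ i, p i * Real.log |A i 0 0|) :
    ∃ η t C r : ℝ, 0 < η ∧ 0 ≤ t ∧ t ≤ 1 ∧ 0 ≤ C ∧ 0 < r ∧ r < 1 ∧ GoodAt p η t C r A := by
  have hp0 : ∀ i, 0 ≤ p i := fun i => (hp i).le
  have hAd : ∀ i, A i 0 0 * A i 1 1 = 1 := by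
    intro i; have := hA i; rw [Matrix.det_fin_two, h01] at this; linarith
  have hA0 : ∀ i, A i 0 0 ≠ 0 := by
    intro i h; have := hAd i; rw [h] at this; norm_num at this
  obtain ⟨i0, hi0⟩ : ∃ i0, A i0 0 0 ≠ A i0 1 1 := by
    by_contra hc
    push Not at hc
    have : ∀ i, Real.log |A i 0 0| = 0 := by
      intro i
      have h1 := hAd i
      rw [← hc i] at h1
      have h2 : |A i 0 0| = 1 := by
        have h3 : |A i 0 0| * |A i 0 0| = 1 := by rw [← abs_mul, h1, abs_one]
        nlinarith [abs_nonneg (A i 0 0)]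
      rw [h2, Real.log_one]
    simp [this] at hpos
  obtain ⟨K, hK0, hK⟩ : ∃ K : ℝ, 0 ≤ K ∧ ∀ i a b, |A i a b| ≤ K := by
    refine ⟨∑ i, ∑ a, ∑ b, |A i a b|, by positivity, fun i a b => ?_⟩
    calc |A i a b| ≤ ∑ b, |A i a b| := Finset.single_le_sum (f := fun b => |A i a b|)
          (fun _ _ => abs_nonneg _) (Finset.mem_univ b)
      _ ≤ ∑ a, ∑ b, |A i a b| := Finset.single_le_sum (f := fun a => ∑ b, |A i a b|)
          (fun _ _ => by positivity) (Finset.mem_univ a)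
      _ ≤ _ := Finset.single_le_sum (f := fun i => ∑ a, ∑ b, |A i a b|)
          (fun _ _ => by positivity) (Finset.mem_univ i)
  -- compact limiting family
  have hScomp : IsCompact (Tb A '' Sβ i0) := (Sβ_compact i0).image (Tb_continuous A)
  obtain ⟨N, γ, K', W, hW, hγ, hK', hU⟩ := UEx_open hp0 hp1 (Tb A '' Sβ i0) hScomp
    (by rintro _ ⟨β, hβ, rfl⟩ i; rw [Matrix.det_fin_two]; simp [Tb, hAd])
    (by rintro _ ⟨β, hβ, rfl⟩; exact Tb_expand hp hp1 hAd hpos hi0 hβ)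
  obtain ⟨η1, hη1, hnear⟩ := near_of_nhdsSet hScomp hW
  obtain ⟨t1, C1, r1, ht1, ht11, hC1, hr1, hr11, hmom⟩ := moment_of_UEx hp0 hp1 (N := N) hγ hK'
  obtain ⟨t2, r2, η2, ht2, ht21, hr2, hr21, hη2, hlow⟩ :=
    lower_scalar hp0 hp1 (fun i => A i 0 0) hA0 hpos
  set θ := min 1 (min (η1 / (K + 1)) η2) with hθ
  have hθp : 0 < θ := by positivity
  have hθ1 : θ ≤ 1 := min_le_left _ _
  have hθη1 : θ * (K + 1) ≤ η1 := by
    rw [← le_div_iff₀ (by positivity)]; exact (min_le_right _ _).trans (min_le_left _ _)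
  have hθη1' : θ ≤ η1 := by nlinarith
  have hθη2 : θ ≤ η2 := (min_le_right _ _).trans (min_le_right _ _)
  obtain ⟨η, hη, hsh⟩ := shear h01 hK0 hK hi0 hθp
  refine ⟨η, max t1 t2, 3 * (C1 + 1), max r1 r2, hη, le_max_of_le_left ht1.le, max_le ht11 ht21, by positivity,
    lt_max_of_lt_left hr1, max_lt hr11 hr21, fun B hB hBn n => ?_⟩
  obtain ⟨τ, hτ, hroot, hent⟩ := hsh B hBn
  have hpow1 : r1 ^ n ≤ max r1 r2 ^ n := pow_le_pow_left₀ hr1.le (le_max_left _ _) n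
  have hpow2 : r2 ^ n ≤ max r1 r2 ^ n := pow_le_pow_left₀ hr2.le (le_max_right _ _) n
  have hpow0 : 0 ≤ max r1 r2 ^ n := (pow_nonneg hr1.le n).trans hpow1
  have hmono : ∀ s, s ≤ max t1 t2 → Ex p B n (fun M => nsq M ^ (-(max t1 t2))) ≤
      Ex p B n (fun M => nsq M ^ (-s)) := by
    intro s hs
    refine Ex_mono hp0 hp1 hB n _ _ fun M hM => ?_
    exact Real.rpow_le_rpow_of_exponent_le (by linarith [two_le_nsq hM]) (by linarith)
  set h : Fin κ → ℝ := fun i => B i 0 1 + τ * (B i 1 1 - B i 0 0) - B i 1 0 * τ ^ 2 with hh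
  by_cases hz : ∀ i, h i = 0
  · -- lower triangular
    have hl := lower_moment hp0 hp1 (T := fun i => Gm τ 1 * B i * Gi τ 1)
      (fun i => cj_det (Gm_Gi one_ne_zero) (hB i))
      (fun i => by
        rw [(G_entries one_ne_zero (B i)).2.1, div_one]; exact hz i) ht2.le
      (hlow _ fun i => by
        rw [(G_entries one_ne_zero (B i)).1]; exact (hent i).1.trans_le hθη2) hr2.le n
    calc _ ≤ Ex p B n (fun M => nsq M ^ (-t2)) := hmono t2 (le_max_right _ _)
      _ ≤ 3 * Ex p (fun i => Gm τ 1 * B i * Gi τ 1) n (fun M => qf (act M (1, 0)) ^ (-t2)) :=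
          G_moment hp0 hp1 hB hτ one_pos le_rfl ht2.le ht21 n
      _ ≤ 3 * r2 ^ n := by linarith
      _ ≤ _ := by nlinarith
  · push Not at hz
    obtain ⟨j, hj⟩ := hz
    haveI : Nonempty (Fin κ) := ⟨i0⟩
    obtain ⟨i1, hi1⟩ := Finite.exists_max (fun i => |h i|)
    set ε := |h i1| with hε
    have hεp : 0 < ε := (abs_pos.2 hj).trans_le (hi1 j)
    have hεθ : ε < θ := (hent i1).2.1
    set β : Fin κ → ℝ := fun i => h i / ε with hβ
    have hβS : β ∈ Sβ i0 := by
      refine ⟨fun i => ?_, ?_, i1, ?_⟩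
      · rw [hβ]; simp only; rw [abs_div, abs_of_pos hεp, div_le_one hεp]; exact hi1 i
      · rw [hβ]; simp only [hh]; rw [hroot, zero_div]
      · rw [hβ]; simp only; rw [abs_div, abs_of_pos hεp, div_self hεp.ne']
    set B3 : Fin κ → Mat2 := fun i => Gm τ ε * B i * Gi τ ε with hB3
    have hB3d : ∀ i, (B3 i).det = 1 := fun i => cj_det (Gm_Gi hεp.ne') (hB i)
    have hn3 : near η1 (Tb A β) B3 := by
      intro i a b
      obtain ⟨g1, g2, g3, g4⟩ := G_entries (τ := τ) hεp.ne' (B i)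
      obtain ⟨k1, k2, k3, k4⟩ := hent i
      fin_cases a <;> fin_cases b
      · show |B3 i 0 0 - Tb A β i 0 0| < η1
        rw [hB3]; simp only; rw [g1]
        have : Tb A β i 0 0 = A i 0 0 := by simp [Tb]
        rw [this]; exact k1.trans_le hθη1'
      · show |B3 i 0 1 - Tb A β i 0 1| < η1
        rw [hB3]; simp only; rw [g2]
        have : Tb A β i 0 1 = h i / ε := by simp [Tb, hβ]
        rw [this, hh]; simp only; rw [sub_self, abs_zero]; exact hη1
      · show |B3 i 1 0 - Tb A β i 1 0| < η1
        rw [hB3]; simp only; rw [g3]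
        have : Tb A β i 1 0 = 0 := by simp [Tb]
        rw [this, sub_zero, abs_mul, abs_of_pos hεp]
        calc ε * |B i 1 0| ≤ ε * (K + 1) := mul_le_mul_of_nonneg_left k4 hεp.le
          _ < θ * (K + 1) := mul_lt_mul_of_pos_right hεθ (by linarith)
          _ ≤ η1 := hθη1
      · show |B3 i 1 1 - Tb A β i 1 1| < η1
        rw [hB3]; simp only; rw [g4]
        have : Tb A β i 1 1 = A i 1 1 := by simp [Tb]
        rw [this]; exact k3.trans_le hθη1'
    have hm := hmom B3 (hU B3 (hnear _ ⟨β, hβS, rfl⟩ B3 hn3) hB3d) n (1, 0)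
      (by rw [qf_e1]; exact one_pos)
    rw [qf_e1, Real.one_rpow, mul_one] at hm
    calc _ ≤ Ex p B n (fun M => nsq M ^ (-t1)) := hmono t1 (le_max_left _ _)
      _ ≤ 3 * Ex p B3 n (fun M => qf (act M (1, 0)) ^ (-t1)) :=
          G_moment hp0 hp1 hB hτ hεp (hεθ.le.trans hθ1) ht1.le ht11 n
      _ ≤ 3 * (C1 * r1 ^ n) := by linarith
      _ ≤ _ := by nlinarith

lemma good_conj {p : Fin κ → ℝ} (hp : ∀ i, 0 ≤ p i) (hp1 : ∑ i, p i = 1) {A : Fin κ → Mat2}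
    {P Q : Mat2} (hPQ : P * Q = 1) {η t C r : ℝ} (hη : 0 < η) (ht0 : 0 ≤ t) (hC : 0 ≤ C)
    (h : GoodAt p η t C r (fun i => P * A i * Q)) :
    ∃ η' C', 0 < η' ∧ 0 ≤ C' ∧ GoodAt p η' t C' r A := by
  have hcont : ∀ i a b, Continuous (fun B : Fin κ → Mat2 => (P * B i * Q) a b) := by
    intro i a b
    have : Continuous (fun B : Fin κ → Mat2 => P * B i * Q) :=
      (continuous_const.matrix_mul (continuous_apply i)).matrix_mul continuous_const
    exact this.matrix_elem a b
  have hW : {B : Fin κ → Mat2 | near η (fun i => P * A i * Q) (fun i => P * B i * Q)} ∈ 𝓝ˢ {A} := by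
    rw [nhdsSet_singleton]
    have : ∀ᶠ B in 𝓝 A, ∀ i a b, |(P * B i * Q) a b - (P * A i * Q) a b| < η := by
      refine eventually_all.2 fun i => eventually_all.2 fun a => eventually_all.2 fun b => ?_
      have hc : ContinuousAt (fun B : Fin κ → Mat2 => |(P * B i * Q) a b - (P * A i * Q) a b|) A :=
        (((hcont i a b).sub continuous_const).abs).continuousAt
      exact hc.eventually (gt_mem_nhds (by simpa using hη))
    exact this
  obtain ⟨η', hη', hn⟩ := near_of_nhdsSet isCompact_singleton hW
  set c := nsq P * nsq Q with hc
  have hc2 : 2 ≤ c := by rw [← nsq_one, ← hPQ]; exact nsq_mul_le P Q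
  have hP0 := nsq_nonneg P
  have hQ0 := nsq_nonneg Q
  set c' := max 1 (c ^ t) with hc'
  refine ⟨η', c' * C, hη', by positivity, fun B hB hBn n => ?_⟩
  have h1 := h (fun i => P * B i * Q) (fun i => cj_det hPQ (hB i)) (hn A rfl B hBn) n
  rw [Ex_conj p B P Q hPQ] at h1
  · calc _ ≤ Ex p B n (fun M => c' * nsq (P * M * Q) ^ (-t)) := by
          refine Ex_mono hp hp1 hB n _ _ fun M hM => ?_
          have hM2 := two_le_nsq (cj_det hPQ hM)
          have hb : nsq (P * M * Q) ≤ nsq M * c := by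
            calc _ ≤ nsq (P * M) * nsq Q := nsq_mul_le _ _
              _ ≤ (nsq P * nsq M) * nsq Q := mul_le_mul_of_nonneg_right (nsq_mul_le _ _) hQ0
              _ = _ := by rw [hc]; ring
          calc nsq M ^ (-t) ≤ (nsq (P * M * Q) / c) ^ (-t) :=
                Real.rpow_le_rpow_of_nonpos (by positivity) (by rwa [div_le_iff₀ (by linarith)])
                  (by linarith)
            _ = c ^ t * nsq (P * M * Q) ^ (-t) := by
                rw [Real.div_rpow (by linarith) (by linarith), Real.rpow_neg (by linarith : (0:ℝ) ≤ c),
                  div_inv_eq_mul, mul_comm]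
            _ ≤ _ := mul_le_mul_of_nonneg_right (le_max_right _ _) (Real.rpow_nonneg (by linarith) _)
      _ = c' * Ex p B n (fun M => nsq (P * M * Q) ^ (-t)) := Ex_smul _ _ _ _ _
      _ ≤ c' * (C * r ^ n) := mul_le_mul_of_nonneg_left h1 (by positivity)
      _ = _ := by ring

end part9

section part10
open MeasureTheory Filter Topology
variable {κ : ℕ}

lemma good_exists {p : Fin κ → ℝ} (hp : ∀ i, 0 < p i) (hp1 : ∑ i, p i = 1) {T : Fin κ → Mat2}
    (hT : ∀ i, (T i).det = 1) {l : ℝ} (hl : HasLam p T l) (hl0 : 0 < l) :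
    ∃ η t C r : ℝ, 0 < η ∧ t ≤ 1 ∧ 0 ≤ C ∧ 0 < r ∧ r < 1 ∧ GoodAt p η t C r T := by
  have hp0 : ∀ i, 0 ≤ p i := fun i => (hp i).le
  rcases dichotomy hp hp1 hT hl hl0 with h | ⟨v, hv, c, hc, hneg⟩
  · exact good_of_expanding hp0 hp1 _ hT h
  · have hc0 : ∀ i, c i ≠ 0 := by
      intro i h0
      have h1 := qf_act_pos (hT i) hv
      rw [hc i, h0, zero_smul] at h1
      simp [qf] at h1
    set w : ℝ × ℝ := (v.2, -v.1) with hw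
    have hwv : wd w v = qf v := by simp [wd, qf, hw]; ring
    have hwv0 : wd w v ≠ 0 := by rw [hwv]; exact hv.ne'
    have hQP := Qm_Pm hwv0
    have hdet : ∀ i, (Qm w v * T i * Pm w v).det = 1 := fun i => cj_det hQP (hT i)
    have h01 : ∀ i, (Qm w v * T i * Pm w v) 0 1 = 0 := by
      intro i
      rw [(cj_entries hwv0 (T i)).2.1, hc i]
      simp [wd]; left; ring
    have h11 : ∀ i, (Qm w v * T i * Pm w v) 1 1 = c i := by
      intro i
      rw [(cj_entries hwv0 (T i)).2.2.2, hc i, div_eq_iff hwv0]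
      simp [wd]; ring
    have h00 : ∀ i, (Qm w v * T i * Pm w v) 0 0 = (c i)⁻¹ := by
      intro i
      have := hdet i
      rw [Matrix.det_fin_two, h01, h11] at this
      have := hc0 i
      field_simp
      linarith
    obtain ⟨η, t, C, r, hη, ht0, ht1, hC, hr, hr1, hg⟩ := tri_moment hp hp1 hdet h01 (by
      simp_rw [h00, abs_inv, Real.log_inv, mul_neg, Finset.sum_neg_distrib]; linarith)
    obtain ⟨η', C', hη', hC', hg'⟩ := good_conj hp0 hp1 hQP hη ht0 hC hg
    exact ⟨η', t, C', r, hη', ht1, hC', hr, hr1, hg'⟩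

lemma near_of_tdist {A B : Fin κ → SL2} {η : ℝ} (h : tdist A B < η / 2) :
    near η (fun i => (A i : Mat2)) (fun i => (B i : Mat2)) := by
  intro i a b
  have h1 := nsq_tdist (B := A) (C := B) i
  have h0 := tdist_nonneg A B
  have h2 : ((A i : Mat2) a b - (B i : Mat2) a b) ^ 2 ≤ (2 * tdist A B) ^ 2 := by
    refine le_trans ?_ h1
    unfold nsq
    simp only [Matrix.sub_apply]
    fin_cases a <;> fin_cases b <;> simp only [Fin.zero_eta, Fin.mk_one] <;> nlinarith [
      sq_nonneg ((A i : Mat2) 0 0 - (B i : Mat2) 0 0), sq_nonneg ((A i : Mat2) 0 1 - (B i : Mat2) 0 1),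
      sq_nonneg ((A i : Mat2) 1 0 - (B i : Mat2) 1 0), sq_nonneg ((A i : Mat2) 1 1 - (B i : Mat2) 1 1)]
  have h3 := abs_le_of_sq_le_sq h2 (by linarith)
  rw [abs_sub_comm] at h3
  show |(B i : Mat2) a b - (A i : Mat2) a b| < η
  linarith

end part10

/-- **Duarte–Klein weak-Hölder theorem.** If `L(A) > 0`, then `L` is weak-Hölder
continuous on a neighborhood of `A`. -/
theorem duarte_klein_weak_holder {κ : ℕ} (hκ : 2 ≤ κ) (p : Fin κ → ℝ)
    (hp : ∀ i, 0 < p i) (hp1 : ∑ i, p i = 1) (A : Fin κ → SL2)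
    (hL : 0 < lyapLC p A) :
    ∃ ε C α β : ℝ, 0 < ε ∧ 0 < C ∧ 0 < α ∧ 0 < β ∧
      ∀ B₁ B₂ : Fin κ → SL2, tdist A B₁ < ε → tdist A B₂ < ε → B₁ ≠ B₂ →
        |lyapLC p B₁ - lyapLC p B₂| ≤
          C * Real.exp (-α * (Real.log (1 / tdist B₁ B₂)) ^ β) := by
  have hp0 : ∀ i, 0 ≤ p i := fun i => (hp i).le
  have hdet : ∀ i, ((A i : Mat2)).det = 1 := fun i => (A i).2
  obtain ⟨η, t, C, r, hη, ht1, hC, hr, hr1, hg⟩ :=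
    good_exists hp hp1 hdet (hasLam_lyap hp0 hp1 A) (by linarith)
  exact reduction hκ hp0 hp1 A (half_pos hη) ht1 hC hr hr1 fun B hB n =>
    hg (fun i => (B i : Mat2)) (fun i => (B i).2) (near_of_tdist hB) n
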